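/- arXiv:1511.01749 — 2 statements merged into one kernel-verified Lean document; each statement's English description precedes it below -/
import Mathlib

section
/- Suppose the Kakeya maximal function inequality $\|M_\delta f\|_{L^r(S^{n-1})} \leq C(\epsilon)\delta^{-(n-s)/s - \epsilon}\|f\|_{L^s(\mathbb{R}^n)}$ holds for all $\epsilon > 0$, with $u \geq 1$, $r > 0$, $1 < s \leq n$. Then for every Kakeya set $K \subset \mathbb{R}^n$ and every quasisymmetric homeomorphism $g \colon K \to (X,d)$ onto a metric space with $\mathcal{H}^{n-1}(\{e \in S^{n-1} : \mathcal{H}^u(g(L_e(x))) > 0 \text{ for some segment } L_e(x) \subset K\}) > 0$, one has $\dim_{\mathrm{H}} g(K) \geq su$. -/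
open Set Metric MeasureTheory ENNReal

noncomputable section

/-- The unit line segment from `x` in direction `e`. -/
def seg {n : ℕ} (e x : EuclideanSpace ℝ (Fin n)) : Set (EuclideanSpace ℝ (Fin n)) :=
  (fun t : ℝ => x + t • e) '' Set.Icc (0:ℝ) 1

/-- The closed `δ`-tube around the unit segment from `x` in direction `e`. -/
def tube {n : ℕ} (δ : ℝ) (e x : EuclideanSpace ℝ (Fin n)) : Set (EuclideanSpace ℝ (Fin n)) :=
  Metric.cthickening δ (seg e x)

/-- The Kakeya maximal function. -/
def kakeyaMax {n : ℕ} (δ : ℝ) (f : EuclideanSpace ℝ (Fin n) → ℝ)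
    (e : EuclideanSpace ℝ (Fin n)) : ℝ≥0∞ :=
  ⨆ x : EuclideanSpace ℝ (Fin n),
    (∫⁻ y in tube δ e x, ENNReal.ofReal |f y|) / volume (tube δ e x)

/-- `η` is a quasisymmetry gauge: an increasing homeomorphism of `[0,∞)` onto itself. -/
def IsQSGauge (η : ℝ → ℝ) : Prop :=
  η 0 = 0 ∧ StrictMonoOn η (Set.Ici 0) ∧ ContinuousOn η (Set.Ici 0) ∧
    Set.MapsTo η (Set.Ici 0) (Set.Ici 0) ∧ Set.SurjOn η (Set.Ici 0) (Set.Ici 0)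

/-- `g` is `η`-quasisymmetric on `K`. -/
def IsQSOn {X Y : Type*} [MetricSpace X] [MetricSpace Y] (η : ℝ → ℝ) (g : X → Y)
    (K : Set X) : Prop :=
  ∀ x ∈ K, ∀ y ∈ K, ∀ z ∈ K, x ≠ z →
    dist (g x) (g y) ≤ η (dist x y / dist x z) * dist (g x) (g z)

/-- Two parallel-indexed points on unit segments with nearby directions are close. -/
theorem dist_segment_points_le {n : ℕ} {e e' x : EuclideanSpace ℝ (Fin n)} {t : ℝ}
    (ht : t ∈ Set.Icc (0 : ℝ) 1) : dist (x + t • e) (x + t • e') ≤ dist e e' := by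
  rw [dist_add_left, dist_smul₀, Real.norm_of_nonneg ht.1]
  exact mul_le_of_le_one_left dist_nonneg ht.2

theorem isCompact_seg {n : ℕ} (e x : EuclideanSpace ℝ (Fin n)) : IsCompact (seg e x) :=
  isCompact_Icc.image (by fun_prop)

/-- A `δ`-tube around a unit segment has volume `O(δ ^ (n - 1))`. -/
theorem exists_volume_tube_le (n : ℕ) : ∃ C > (0 : ℝ), ∀ δ ∈ Set.Ioo (0 : ℝ) 1,
    ∀ e x : EuclideanSpace ℝ (Fin n), ‖e‖ = 1 →
      volume (tube δ e x) ≤ ENNReal.ofReal (C * δ ^ n / δ) := by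
  set v := volume (ball (0 : EuclideanSpace ℝ (Fin n)) 1) with hv
  have hvtop : v ≠ ∞ := measure_ball_lt_top.ne
  refine ⟨2 * 3 ^ n * (v.toReal + 1), by positivity, fun δ hδ e x he => ?_⟩
  obtain ⟨hδ0, hδ1⟩ := hδ
  set N := ⌊1 / δ⌋₊
  have hN : (N : ℝ) ≤ 1 / δ := Nat.floor_le (by positivity)
  have hsub : tube δ e x ⊆ ⋃ j ∈ Finset.range (N + 1), closedBall (x + (j * δ) • e) (3 * δ) := by
    intro z hz
    rw [tube, (isCompact_seg e x).cthickening_eq_biUnion_closedBall hδ0.le] at hz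
    simp only [Set.mem_iUnion, exists_prop] at hz
    obtain ⟨p, ⟨t, ht, rfl⟩, hz⟩ := hz
    have hfl : (⌊t / δ⌋₊ : ℝ) ≤ t / δ := Nat.floor_le (div_nonneg ht.1 hδ0.le)
    have hlt : t / δ < ⌊t / δ⌋₊ + 1 := Nat.lt_floor_add_one _
    rw [le_div_iff₀ hδ0] at hfl
    rw [div_lt_iff₀ hδ0] at hlt
    simp only [Set.mem_iUnion, exists_prop, Finset.mem_range, mem_closedBall]
    refine ⟨⌊t / δ⌋₊, Nat.lt_succ_of_le (Nat.floor_le_floor ?_), ?_⟩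
    · exact div_le_div_of_nonneg_right ht.2 hδ0.le
    · have h1 : dist (x + t • e) (x + (⌊t / δ⌋₊ * δ : ℝ) • e) ≤ δ := by
        rw [dist_add_left, dist_eq_norm, ← sub_smul, norm_smul, he, mul_one, Real.norm_eq_abs,
          abs_le]
        constructor <;> linarith
      have h2 : dist z (x + t • e) ≤ δ := hz
      linarith [dist_triangle z (x + t • e) (x + (⌊t / δ⌋₊ * δ : ℝ) • e)]
  calc volume (tube δ e x)
      ≤ ∑ j ∈ Finset.range (N + 1),
          volume (closedBall (x + ((j : ℝ) * δ) • e) (3 * δ)) :=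
        (measure_mono hsub).trans (measure_biUnion_finset_le _ _)
    _ = (N + 1 : ℕ) * (ENNReal.ofReal ((3 * δ) ^ n) * v) := by
        simp [Measure.addHaar_closedBall _ _ (by positivity : 0 ≤ 3 * δ), hv]
    _ = ENNReal.ofReal ((N + 1 : ℕ) * ((3 * δ) ^ n * v.toReal)) := by
        rw [ENNReal.ofReal_mul (by positivity), ENNReal.ofReal_natCast,
          ENNReal.ofReal_mul (by positivity), ENNReal.ofReal_toReal hvtop]
    _ ≤ _ := by
        apply ENNReal.ofReal_le_ofReal
        have hN' : ((N + 1 : ℕ) : ℝ) ≤ 2 / δ := by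
          push_cast
          have : 1 ≤ 1 / δ := by rw [le_div_iff₀ hδ0]; linarith
          calc (N : ℝ) + 1 ≤ 1 / δ + 1 / δ := by linarith
            _ = 2 / δ := by ring
        calc ((N + 1 : ℕ) : ℝ) * ((3 * δ) ^ n * v.toReal)
            ≤ 2 / δ * ((3 * δ) ^ n * (v.toReal + 1)) := by
              gcongr
              linarith
          _ = _ := by rw [mul_pow]; ring

/-- The index of the cube of side `ℓ` containing a point. -/
def cubeIdx {n : ℕ} (ℓ : ℝ) (x : EuclideanSpace ℝ (Fin n)) : Fin n → ℤ := fun j => ⌊x j / ℓ⌋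

theorem measurable_cubeIdx {n : ℕ} (ℓ : ℝ) : Measurable (cubeIdx (n := n) ℓ) := by
  refine measurable_pi_lambda _ fun j => Int.measurable_floor.comp ?_
  fun_prop

theorem volume_cubeIdx_preimage {n : ℕ} {ℓ : ℝ} (hℓ : 0 < ℓ) (q : Fin n → ℤ) :
    volume (cubeIdx (n := n) ℓ ⁻¹' {q}) = ENNReal.ofReal (ℓ ^ n) := by
  have h : cubeIdx (n := n) ℓ ⁻¹' {q} = WithLp.ofLp ⁻¹'
      (Set.univ.pi fun j => Set.Ico (q j * ℓ) ((q j + 1) * ℓ)) := by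
    ext x
    simp [cubeIdx, funext_iff, Int.floor_eq_iff, le_div_iff₀ hℓ, div_lt_iff₀ hℓ]
  rw [h, (PiLp.volume_preserving_ofLp (Fin n)).measure_preimage
    (MeasurableSet.univ_pi fun _ => measurableSet_Ico).nullMeasurableSet, Real.volume_pi_Ico]
  simp only [add_mul, one_mul, add_sub_cancel_left, Finset.prod_const, Finset.card_univ,
    Fintype.card_fin, ENNReal.ofReal_pow hℓ.le]

theorem dist_le_of_cubeIdx_eq {n : ℕ} {ℓ : ℝ} (hℓ : 0 < ℓ) {x y : EuclideanSpace ℝ (Fin n)}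
    (h : cubeIdx ℓ x = cubeIdx ℓ y) : dist x y ≤ n * ℓ := by
  rw [EuclideanSpace.dist_eq]
  have hj (j : Fin n) : dist (x j) (y j) ≤ ℓ := by
    have := Int.abs_sub_lt_one_of_floor_eq_floor (congrFun h j)
    rw [← sub_div, abs_div, abs_of_pos hℓ, div_lt_one hℓ] at this
    exact this.le
  refine Real.sqrt_le_iff.2 ⟨by positivity, ?_⟩
  calc ∑ j, dist (x j) (y j) ^ 2 ≤ ∑ _j : Fin n, ℓ ^ 2 :=
        Finset.sum_le_sum fun j _ => pow_le_pow_left₀ dist_nonneg (hj j) 2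
    _ = n * ℓ ^ 2 := by simp
    _ ≤ n ^ 2 * ℓ ^ 2 := by
        gcongr
        exact_mod_cast Nat.le_self_pow two_ne_zero n
    _ = (n * ℓ) ^ 2 := by ring

theorem cubeIdx_mem_Icc {n M : ℕ} {ℓ : ℝ} (hℓ : 0 < ℓ) {x y : EuclideanSpace ℝ (Fin n)}
    (h : dist x y ≤ M * ℓ) (j : Fin n) :
    cubeIdx ℓ y j ∈ Finset.Icc (cubeIdx ℓ x j - M) (cubeIdx ℓ x j + M) := by
  have hj : |x j - y j| ≤ M * ℓ := by
    have := PiLp.norm_apply_le (x - y) j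
    rw [← dist_eq_norm] at this
    simpa using this.trans h
  rw [abs_le] at hj
  have e1 : y j / ℓ ≤ x j / ℓ + M := by
    rw [div_add' _ _ _ hℓ.ne']; gcongr; linarith
  have e2 : x j / ℓ ≤ y j / ℓ + M := by
    rw [div_add' _ _ _ hℓ.ne']; gcongr; linarith
  have f1 := Int.floor_le_floor e1
  have f2 := Int.floor_le_floor e2
  rw [Int.floor_add_natCast] at f1 f2
  simp only [cubeIdx, Finset.mem_Icc]
  omega

/-- A set of diameter at most `M * ℓ` meets at most `(2 * M + 1) ^ n` cubes of side `ℓ`. -/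
theorem encard_cubeIdx_image_le {n M : ℕ} {ℓ : ℝ} (hℓ : 0 < ℓ)
    {V : Set (EuclideanSpace ℝ (Fin n))} (hV : ∀ x ∈ V, ∀ y ∈ V, dist x y ≤ M * ℓ) :
    (cubeIdx ℓ '' V).encard ≤ ((2 * M + 1) ^ n : ℕ) := by
  rcases V.eq_empty_or_nonempty with rfl | ⟨x, hx⟩
  · simp
  set F := Fintype.piFinset fun j => Finset.Icc (cubeIdx ℓ x j - M) (cubeIdx ℓ x j + M) with hF
  have hsub : cubeIdx ℓ '' V ⊆ (F : Set (Fin n → ℤ)) := by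
    rintro _ ⟨y, hy, rfl⟩
    rw [Finset.mem_coe, hF, Fintype.mem_piFinset]
    exact cubeIdx_mem_Icc hℓ (hV x hx y hy)
  refine (Set.encard_le_encard hsub).trans ?_
  rw [Set.encard_coe_eq_coe_finsetCard, hF, Fintype.card_piFinset]
  have : ∀ j, (Finset.Icc (cubeIdx ℓ x j - M) (cubeIdx ℓ x j + M)).card = 2 * M + 1 := by
    intro j; rw [Int.card_Icc]; omega
  simp [this]

theorem setLIntegral_comp_cubeIdx {n : ℕ} (ℓ : ℝ) (F : (Fin n → ℤ) → ℝ≥0∞)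
    {A : Set (EuclideanSpace ℝ (Fin n))} (hA : MeasurableSet A) :
    ∫⁻ y in A, F (cubeIdx ℓ y) = ∑' q, F q * volume (cubeIdx ℓ ⁻¹' {q} ∩ A) := by
  rw [← lintegral_map (f := F) (Measurable.of_discrete) (measurable_cubeIdx ℓ),
    lintegral_countable']
  refine tsum_congr fun q => ?_
  rw [Measure.map_apply (measurable_cubeIdx ℓ) (measurableSet_singleton q),
    Measure.restrict_apply' hA]

theorem kakeyaMax_cubeIdx_ge {n : ℕ} (hn : 0 < n) {C δ : ℝ} (hC : 0 < C) (hδ : 0 < δ)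
    (htube : ∀ e x : EuclideanSpace ℝ (Fin n), ‖e‖ = 1 →
      volume (tube δ e x) ≤ ENNReal.ofReal (C * δ ^ n / δ))
    {w : (Fin n → ℤ) → ℝ≥0∞} (hw : ∀ q, w q ≠ ∞)
    {e e' : EuclideanSpace ℝ (Fin n)} (he' : ‖e'‖ = 1) (hee : dist e e' ≤ δ / 2)
    (x : EuclideanSpace ℝ (Fin n)) :
    (∑' q, (cubeIdx (δ / (2 * n)) '' seg e x).indicator w q) *
        ENNReal.ofReal (δ / (C * (2 * n) ^ n)) ≤
      kakeyaMax δ (fun y => (w (cubeIdx (δ / (2 * n)) y)).toReal) e' := by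
  have hn' : (0 : ℝ) < n := by exact_mod_cast hn
  set ℓ := δ / (2 * n) with hℓdef
  have hℓ : 0 < ℓ := by positivity
  have hnℓ : n * ℓ = δ / 2 := by rw [hℓdef]; field_simp
  refine le_trans ?_ (le_iSup _ x)
  have hmeas : MeasurableSet (tube δ e' x) := isClosed_cthickening.measurableSet
  have hsub : ∀ q ∈ cubeIdx ℓ '' seg e x, cubeIdx ℓ ⁻¹' {q} ⊆ tube δ e' x := by
    rintro _ ⟨_, ⟨t, ht, rfl⟩, rfl⟩ z hz
    refine mem_cthickening_of_dist_le z (x + t • e') δ _ ⟨t, ht, rfl⟩ ?_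
    have h1 := dist_le_of_cubeIdx_eq hℓ (show cubeIdx ℓ z = cubeIdx ℓ (x + t • e) from hz)
    have h2 := (dist_segment_points_le (e := e) (e' := e') (x := x) ht).trans hee
    linarith [dist_triangle z (x + t • e) (x + t • e')]
  have hint : ∫⁻ y in tube δ e' x, ENNReal.ofReal |(w (cubeIdx ℓ y)).toReal| =
      ∑' q, w q * volume (cubeIdx ℓ ⁻¹' {q} ∩ tube δ e' x) := by
    rw [← setLIntegral_comp_cubeIdx ℓ w hmeas]
    simp only [abs_of_nonneg ENNReal.toReal_nonneg, ENNReal.ofReal_toReal (hw _)]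
  have hnum : (∑' q, (cubeIdx ℓ '' seg e x).indicator w q) * ENNReal.ofReal (ℓ ^ n) ≤
      ∫⁻ y in tube δ e' x, ENNReal.ofReal |(w (cubeIdx ℓ y)).toReal| := by
    rw [hint, ← ENNReal.tsum_mul_right]
    refine ENNReal.tsum_le_tsum fun q => ?_
    by_cases hq : q ∈ cubeIdx ℓ '' seg e x
    · rw [Set.indicator_of_mem hq, Set.inter_eq_left.2 (hsub q hq), volume_cubeIdx_preimage hℓ]
    · simp [Set.indicator_of_notMem hq]
  calc (∑' q, (cubeIdx ℓ '' seg e x).indicator w q) * ENNReal.ofReal (δ / (C * (2 * n) ^ n))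
      = (∑' q, (cubeIdx ℓ '' seg e x).indicator w q) * ENNReal.ofReal (ℓ ^ n) /
          ENNReal.ofReal (C * δ ^ n / δ) := by
        rw [mul_div_assoc, ← ENNReal.ofReal_div_of_pos (by positivity)]
        congr 2
        rw [hℓdef, div_pow]
        field_simp
    _ ≤ _ := ENNReal.div_le_div hnum (htube e' x he')

/-- A maximal inequality, tested on functions constant on grid cubes, bounds the measure of any
(possibly nonmeasurable) set of directions having a segment through heavy cubes. -/
theorem discrete_maximal_inequality {n : ℕ} (hn : 0 < n) {C δ r s : ℝ} (hC : 0 < C) (hδ : 0 < δ)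
    (hr : 0 < r) {B : ℝ≥0∞}
    (htube : ∀ e x : EuclideanSpace ℝ (Fin n), ‖e‖ = 1 →
      volume (tube δ e x) ≤ ENNReal.ofReal (C * δ ^ n / δ))
    {μ : Measure (EuclideanSpace ℝ (Fin n))}
    (hmax : ∀ f : EuclideanSpace ℝ (Fin n) → ℝ, Measurable f →
      (∫⁻ e in sphere (0 : EuclideanSpace ℝ (Fin n)) 1, (kakeyaMax δ f e) ^ r ∂μ) ^ (1 / r) ≤
        B * (∫⁻ y, ENNReal.ofReal |f y| ^ s) ^ (1 / s))
    {w : (Fin n → ℤ) → ℝ≥0∞} (hw : ∀ q, w q ≠ ∞) {c : ℝ≥0∞}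
    {A : Set (EuclideanSpace ℝ (Fin n))} (hA : A ⊆ sphere 0 1)
    (hc : ∀ e ∈ A, ∃ x, c ≤ ∑' q, (cubeIdx (δ / (2 * n)) '' seg e x).indicator w q) :
    c * ENNReal.ofReal (δ / (C * (2 * n) ^ n)) * μ A ^ (1 / r) ≤
      B * ((∑' q, w q ^ s) * ENNReal.ofReal ((δ / (2 * n)) ^ n)) ^ (1 / s) := by
  have hn' : (0 : ℝ) < n := by exact_mod_cast hn
  set ℓ := δ / (2 * n) with hℓdef
  have hℓ : 0 < ℓ := by positivity
  set f : EuclideanSpace ℝ (Fin n) → ℝ := fun y => (w (cubeIdx ℓ y)).toReal with hf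
  set a := c * ENNReal.ofReal (δ / (C * (2 * n) ^ n)) with ha
  have hfm : Measurable f := by
    have : Measurable fun q : Fin n → ℤ => (w q).toReal := Measurable.of_discrete
    exact this.comp (measurable_cubeIdx ℓ)
  have hnorm : ∫⁻ y, ENNReal.ofReal |f y| ^ s = (∑' q, w q ^ s) * ENNReal.ofReal (ℓ ^ n) := by
    have h := setLIntegral_comp_cubeIdx ℓ (fun q => w q ^ s) MeasurableSet.univ
    simp only [Measure.restrict_univ, Set.inter_univ, volume_cubeIdx_preimage hℓ] at h
    rw [← ENNReal.tsum_mul_right, ← h]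
    simp only [hf, abs_of_nonneg ENNReal.toReal_nonneg, ENNReal.ofReal_toReal (hw _)]
  have hlow : a ^ r * μ A ≤ ∫⁻ e in sphere (0 : EuclideanSpace ℝ (Fin n)) 1,
      (kakeyaMax δ f e) ^ r ∂μ := by
    set G := thickening (δ / 2) A with hG
    have hGm : MeasurableSet G := isOpen_thickening.measurableSet
    calc a ^ r * μ A ≤ a ^ r * μ.restrict (sphere 0 1) G := by
          refine mul_le_mul' le_rfl ?_
          rw [Measure.restrict_apply hGm]
          exact measure_mono (Set.subset_inter (self_subset_thickening (by positivity) A) hA)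
      _ = ∫⁻ e in sphere (0 : EuclideanSpace ℝ (Fin n)) 1, G.indicator (fun _ => a ^ r) e ∂μ := by
          rw [lintegral_indicator_const hGm]
      _ ≤ _ := by
          refine setLIntegral_mono' isClosed_sphere.measurableSet fun e' he' => ?_
          by_cases h : e' ∈ G
          · rw [Set.indicator_of_mem h]
            obtain ⟨e, he, hd⟩ := mem_thickening_iff.1 h
            obtain ⟨x, hx⟩ := hc e he
            refine ENNReal.rpow_le_rpow (le_trans ?_ (kakeyaMax_cubeIdx_ge hn hC hδ htube hw
              (mem_sphere_zero_iff_norm.1 he') (by rw [dist_comm]; exact hd.le) x)) hr.le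
            exact mul_le_mul_left hx _
          · simp [Set.indicator_of_notMem h]
  calc a * μ A ^ (1 / r) = (a ^ r * μ A) ^ (1 / r) := by
        rw [ENNReal.mul_rpow_of_nonneg _ _ (by positivity), ← ENNReal.rpow_mul,
          mul_one_div_cancel hr.ne', ENNReal.rpow_one]
    _ ≤ _ := ENNReal.rpow_le_rpow hlow (by positivity)
    _ ≤ _ := hmax f hfm
    _ = _ := by rw [hnorm]

/-- A sum exceeding `c` has a term exceeding the corresponding term of a geometric series. -/
theorem exists_geometric_lt_of_le_tsum {σ c : ℝ} (hσ0 : 0 < σ) (hσ1 : σ < 1) (hc : 0 < c)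
    {F : ℕ → ℝ≥0∞} (hF : ENNReal.ofReal c ≤ ∑' k, F k) :
    ∃ k, ENNReal.ofReal (c / 2 * (1 - σ) * σ ^ k) < F k := by
  by_contra! h
  have h1 : 0 < 1 - σ := by linarith
  have hs : HasSum (fun k => c / 2 * (1 - σ) * σ ^ k) (c / 2) := by
    have := (hasSum_geometric_of_lt_one hσ0.le hσ1).mul_left (c / 2 * (1 - σ))
    rwa [mul_assoc, mul_inv_cancel₀ h1.ne', mul_one] at this
  have hle := hF.trans (ENNReal.tsum_le_tsum h)
  rw [← ENNReal.ofReal_tsum_of_nonneg (fun k => by positivity) hs.summable, hs.tsum_eq,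
    ENNReal.ofReal_le_ofReal_iff (by positivity)] at hle
  linarith

section Quasisymmetric

variable {n : ℕ} {X : Type*} [MetricSpace X] {g : EuclideanSpace ℝ (Fin n) → X} {η : ℝ → ℝ}
  {T : Set (EuclideanSpace ℝ (Fin n))} {R : ℝ}

theorem IsQSOn.dist_le_of_ratio_le (hη : IsQSGauge η) (hqs : IsQSOn η g T)
    {x y z : EuclideanSpace ℝ (Fin n)} (hx : x ∈ T) (hy : y ∈ T) (hz : z ∈ T) (hxz : x ≠ z) {κ : ℝ}
    (hκ : dist x y ≤ κ * dist x z) : dist (g x) (g y) ≤ η κ * dist (g x) (g z) := by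
  have hpos : 0 < dist x z := dist_pos.2 hxz
  have hle : dist x y / dist x z ≤ κ := (div_le_iff₀ hpos).2 hκ
  have h0 : 0 ≤ dist x y / dist x z := by positivity
  refine (hqs x hx y hy z hz hxz).trans (mul_le_mul_of_nonneg_right ?_ dist_nonneg)
  exact hη.2.1.monotoneOn h0 (h0.trans hle) hle

/-- A quasisymmetric map on a bounded uniformly perfect set is Hölder continuous. -/
theorem IsQSOn.exists_geometric_modulus (hη : IsQSGauge η) (hqs : IsQSOn η g T)
    (hR : ∀ x ∈ T, ∀ y ∈ T, dist x y ≤ R)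
    (hT : ∀ x ∈ T, ∀ ρ ∈ Set.Icc (0 : ℝ) (1 / 2), ∃ y ∈ T, dist x y = ρ) :
    ∃ l ∈ Set.Ioo (0 : ℝ) 1, ∃ D > (0 : ℝ), ∀ k : ℕ, ∀ x ∈ T, ∀ z ∈ T,
      dist x z ≤ l ^ k / 2 → dist (g x) (g z) ≤ D * (1 / 2) ^ k := by
  obtain ⟨hη0, -, hηc, hηm, -⟩ := id hη
  obtain ⟨a, ha, hηa⟩ := Metric.continuousWithinAt_iff.1
    (hηc 0 Set.self_mem_Ici) (1 / 2) (by norm_num)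
  set l := min (a / 2) (1 / 2) with hl
  have hl0 : 0 < l := lt_min (by positivity) (by norm_num)
  have hl1 : l ≤ 1 / 2 := min_le_right _ _
  have hηl : η l ≤ 1 / 2 := by
    have hla : dist l 0 < a := by
      rw [Real.dist_0_eq_abs, abs_of_pos hl0]
      linarith [min_le_left (a / 2) (1 / 2 : ℝ)]
    have := hηa (Set.mem_Ici.2 hl0.le) hla
    rw [hη0, Real.dist_0_eq_abs] at this
    exact (le_abs_self _).trans this.le
  refine ⟨l, ⟨hl0, by linarith⟩, ?_⟩
  rcases T.eq_empty_or_nonempty with rfl | ⟨x₀, hx₀⟩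
  · exact ⟨1, one_pos, by simp⟩
  obtain ⟨y₀, hy₀, hxy⟩ := hT x₀ hx₀ (1 / 2) ⟨by norm_num, le_rfl⟩
  have hne : x₀ ≠ y₀ := dist_pos.1 (by rw [hxy]; norm_num)
  have hR0 : 0 ≤ R := dist_nonneg.trans (hR x₀ hx₀ x₀ hx₀)
  have hηR : 0 ≤ η (2 * R) := hηm (Set.mem_Ici.2 (by positivity))
  have hb : ∀ z ∈ T, dist (g x₀) (g z) ≤ η (2 * R) * dist (g x₀) (g y₀) := fun z hz =>
    hqs.dist_le_of_ratio_le hη hx₀ hz hy₀ hne (by rw [hxy]; linarith [hR x₀ hx₀ z hz])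
  refine ⟨2 * (η (2 * R) * dist (g x₀) (g y₀)) + 1, by positivity, fun k => ?_⟩
  induction k with
  | zero =>
    intro x hx z hz _
    linarith [dist_triangle_left (g x) (g z) (g x₀), hb x hx, hb z hz]
  | succ k ih =>
    intro x hx z hz hxz
    have hlk : l ^ k ≤ 1 := pow_le_one₀ hl0.le (by linarith)
    have hlk0 : 0 < l ^ k := by positivity
    obtain ⟨y, hy, hxy⟩ := hT x hx (l ^ k / 2) ⟨by positivity, by linarith⟩
    have hne : x ≠ y := dist_pos.1 (by rw [hxy]; positivity)
    calc dist (g x) (g z) ≤ η l * dist (g x) (g y) :=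
          hqs.dist_le_of_ratio_le hη hx hz hy hne (by rw [hxy]; rw [pow_succ] at hxz; linarith)
      _ ≤ 1 / 2 * ((2 * (η (2 * R) * dist (g x₀) (g y₀)) + 1) * (1 / 2) ^ k) := by
          gcongr
          exact ih x hx y hy hxy.le
      _ = _ := by rw [pow_succ]; ring

/-- A nontrivial subset `V` of `T` has a scale at which boundedly many cubes cover it, and the
image of each of these cubes is not much larger than the image of `V`. -/
theorem IsQSOn.exists_scale (hη : IsQSGauge η) (hqs : IsQSOn η g T)
    (hR : ∀ x ∈ T, ∀ y ∈ T, dist x y ≤ R) (hR0 : 0 < R) {l : ℝ} (hl : l ∈ Set.Ioo (0 : ℝ) 1)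
    {a : ℝ} (ha : 0 < a) :
    ∃ C : ℝ, ∃ N : ℕ, ∀ V ⊆ T, V.Nontrivial → ∃ k : ℕ,
      (cubeIdx (a * l ^ k) '' V).encard ≤ N ∧
      ∀ q ∈ cubeIdx (a * l ^ k) '' V,
        ediam (g '' (T ∩ cubeIdx (a * l ^ k) ⁻¹' {q})) ≤ ENNReal.ofReal C * ediam (g '' V) := by
  obtain ⟨hl0, hl1⟩ := hl
  set κ := 4 * n * a / (R * l) with hκ
  have hηκ : 0 ≤ η κ := hη.2.2.2.1 (Set.mem_Ici.2 (by positivity))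
  refine ⟨2 * η κ, (2 * ⌈R / a⌉₊ + 1) ^ n, fun V hVT hV => ?_⟩
  have hVb : Bornology.IsBounded V :=
    isBounded_iff.2 ⟨R, fun x hx y hy => hR x (hVT hx) y (hVT hy)⟩
  set d := diam V with hd
  have hd0 : 0 < d := by
    obtain ⟨x, hx, y, hy, hxy⟩ := hV
    exact (dist_pos.2 hxy).trans_le (dist_le_diam_of_mem hVb hx hy)
  have hdR : d ≤ R := diam_le_of_forall_dist_le hR0.le fun x hx y hy => hR x (hVT hx) y (hVT hy)
  obtain ⟨k, hk1, hk2⟩ := exists_nat_pow_near_of_lt_one (div_pos hd0 hR0)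
    ((div_le_one hR0).2 hdR) hl0 hl1
  rw [lt_div_iff₀ hR0] at hk1
  rw [div_le_iff₀ hR0] at hk2
  have hak : 0 < a * l ^ k := by positivity
  refine ⟨k, encard_cubeIdx_image_le hak fun x hx y hy => ?_, ?_⟩
  · calc dist x y ≤ d := dist_le_diam_of_mem hVb hx hy
      _ ≤ l ^ k * R := hk2
      _ = R / a * (a * l ^ k) := by field_simp
      _ ≤ _ := by gcongr; exact Nat.le_ceil _
  rintro _ ⟨x, hx, rfl⟩
  obtain ⟨y, hy, hxy⟩ : ∃ y ∈ V, d / 4 < dist x y := by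
    by_contra! h
    have : d ≤ d / 2 := diam_le_of_forall_dist_le (by positivity) fun p hp q hq => by
      linarith [dist_triangle_left p q x, h p hp, h q hq]
    linarith
  have hne : x ≠ y := dist_pos.1 (by linarith)
  have hz : ∀ z ∈ T ∩ cubeIdx (a * l ^ k) ⁻¹' {cubeIdx (a * l ^ k) x},
      edist (g x) (g z) ≤ ENNReal.ofReal (η κ) * ediam (g '' V) := by
    rintro z ⟨hzT, hzq⟩
    have h1 : dist x z ≤ n * (a * l ^ k) :=
      dist_le_of_cubeIdx_eq hak (show cubeIdx _ x = cubeIdx _ z from Eq.symm hzq)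
    have h2 : dist (g x) (g z) ≤ η κ * dist (g x) (g y) := by
      refine hqs.dist_le_of_ratio_le hη (hVT hx) hzT (hVT hy) hne (h1.trans ?_)
      calc n * (a * l ^ k) = κ * (l ^ (k + 1) * R / 4) := by rw [hκ, pow_succ]; field_simp
        _ ≤ κ * dist x y := by gcongr; linarith
    rw [edist_dist]
    refine (ENNReal.ofReal_le_ofReal h2).trans ?_
    rw [ENNReal.ofReal_mul hηκ, ← edist_dist]
    gcongr
    exact edist_le_ediam_of_mem (Set.mem_image_of_mem g hx) (Set.mem_image_of_mem g hy)
  refine ediam_le ?_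
  rintro _ ⟨p, hp, rfl⟩ _ ⟨q, hq, rfl⟩
  calc edist (g p) (g q) ≤ edist (g x) (g p) + edist (g x) (g q) := edist_triangle_left _ _ _
    _ ≤ _ := add_le_add (hz p hp) (hz q hq)
    _ = _ := by
      rw [← two_mul, ← mul_assoc, ENNReal.ofReal_mul zero_le_two, ENNReal.ofReal_ofNat]

end Quasisymmetric

/-- A set whose image is `μH[t]`-null is covered by grid cubes of various scales, whose images have
small total `t`-content at each scale and dominate the `u`-content of the image of each subset. -/
theorem exists_cube_family {n : ℕ} {X : Type*} [MetricSpace X] [MeasurableSpace X] [BorelSpace X]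
    {g : EuclideanSpace ℝ (Fin n) → X} {T : Set (EuclideanSpace ℝ (Fin n))} {ℓ : ℕ → ℝ}
    {C : ℝ} {N : ℕ} {t u : ℝ} (ht : 0 < t) (hu : 0 < u) (hnull : μH[t] (g '' T) = 0)
    (hscale : ∀ V ⊆ T, V.Nontrivial → ∃ k : ℕ, (cubeIdx (ℓ k) '' V).encard ≤ N ∧
      ∀ q ∈ cubeIdx (ℓ k) '' V,
        ediam (g '' (T ∩ cubeIdx (ℓ k) ⁻¹' {q})) ≤ ENNReal.ofReal C * ediam (g '' V))
    {ρ ε : ℝ≥0∞} (hρ : ρ ≠ 0) (hε : ε ≠ 0) :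
    ∃ Q : ℕ → Set (Fin n → ℤ),
      (∀ A ⊆ T, OuterMeasure.mkMetric'.pre (fun s : Set X => ediam s ^ u) ρ (g '' A) ≤
        ∑' k, ∑' q, (cubeIdx (ℓ k) '' A).indicator ((Q k).indicator
          fun q => ediam (g '' (T ∩ cubeIdx (ℓ k) ⁻¹' {q})) ^ u) q) ∧
      ∀ k, ∑' q, (Q k).indicator
        (fun q => ediam (g '' (T ∩ cubeIdx (ℓ k) ⁻¹' {q})) ^ t) q ≤ ε := by
  classical
  choose! κ hκN hκ using hscale
  set c := ENNReal.ofReal C with hc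
  have hctop : c ≠ ∞ := ENNReal.ofReal_ne_top
  obtain ⟨ρ', hρ'0, hρ'⟩ : ∃ ρ' : ℝ≥0∞, 0 < ρ' ∧ c * ρ' ≤ ρ := by
    refine ⟨ρ / (c + 1), ENNReal.div_pos hρ (by finiteness), ?_⟩
    rw [← mul_div_assoc]
    refine ENNReal.div_le_of_le_mul ?_
    rw [mul_comm]
    exact mul_le_mul' le_rfl le_self_add
  obtain ⟨ε', hε'0, hε'⟩ : ∃ ε' : ℝ≥0∞, 0 < ε' ∧ N * c ^ t * ε' ≤ ε := by
    have hfin : (N : ℝ≥0∞) * c ^ t ≠ ∞ :=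
      ENNReal.mul_ne_top (ENNReal.natCast_ne_top N) (ENNReal.rpow_ne_top_of_nonneg ht.le hctop)
    refine ⟨ε / (N * c ^ t + 1), ENNReal.div_pos hε (by finiteness), ?_⟩
    rw [← mul_div_assoc]
    refine ENNReal.div_le_of_le_mul ?_
    rw [mul_comm]
    exact mul_le_mul' le_rfl le_self_add
  obtain ⟨U, hUcov, hUd, hUsum⟩ : ∃ U : ℕ → Set X, g '' T ⊆ ⋃ i, U i ∧
      (∀ i, ediam (U i) ≤ ρ') ∧ ∑' i, ⨆ _ : (U i).Nonempty, ediam (U i) ^ t < ε' := by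
    rw [Measure.hausdorffMeasure_apply] at hnull
    have h0 := ENNReal.iSup_eq_zero.1 (ENNReal.iSup_eq_zero.1 hnull ρ') hρ'0
    have hlt := h0.trans_lt hε'0
    simpa only [iInf_lt_iff, exists_prop] using hlt
  set V : ℕ → Set (EuclideanSpace ℝ (Fin n)) := fun i => T ∩ g ⁻¹' U i with hV
  have hVT : ∀ i, V i ⊆ T := fun i => Set.inter_subset_left
  have hVU : ∀ i, ediam (g '' V i) ≤ ediam (U i) := fun i =>
    ediam_mono (Set.image_subset_iff.2 Set.inter_subset_right)
  set B : ℕ → ℕ → Set (Fin n → ℤ) := fun k i =>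
    if (V i).Nontrivial ∧ κ (V i) = k then cubeIdx (ℓ k) '' V i else ∅ with hB
  set d : ℕ → (Fin n → ℤ) → ℝ≥0∞ := fun k q => ediam (g '' (T ∩ cubeIdx (ℓ k) ⁻¹' {q})) with hd
  have hBd : ∀ k i, ∀ q ∈ B k i, d k q ≤ c * ediam (U i) := by
    intro k i q hq
    simp only [hB] at hq
    split_ifs at hq with h
    · obtain ⟨hnt, rfl⟩ := h
      exact (hκ _ (hVT i) hnt q hq).trans (mul_le_mul' le_rfl (hVU i))
    · exact hq.elim
  refine ⟨fun k => ⋃ i, B k i, fun A hA => ?_, fun k => ?_⟩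
  · set P := OuterMeasure.mkMetric'.pre (fun s : Set X => ediam s ^ u) ρ with hP
    set J : ℕ → (Fin n → ℤ) → Set X := fun k q =>
      if q ∈ cubeIdx (ℓ k) '' A ∧ q ∈ ⋃ i, B k i then g '' (T ∩ cubeIdx (ℓ k) ⁻¹' {q}) else ∅
      with hJ
    set Z : ℕ → Set X := fun i => if (V i).Nontrivial then ∅ else g '' V i with hZ
    have hcov : g '' A ⊆ (⋃ i, Z i) ∪ ⋃ k, ⋃ q, J k q := by
      rintro _ ⟨x, hx, rfl⟩
      obtain ⟨i, hi⟩ := Set.mem_iUnion.1 (hUcov (Set.mem_image_of_mem g (hA hx)))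
      have hxV : x ∈ V i := ⟨hA hx, hi⟩
      by_cases hnt : (V i).Nontrivial
      · right
        refine Set.mem_iUnion₂.2 ⟨κ (V i), cubeIdx (ℓ (κ (V i))) x, ?_⟩
        simp only [hJ]
        rw [if_pos]
        · exact ⟨x, ⟨hA hx, rfl⟩, rfl⟩
        · refine ⟨⟨x, hx, rfl⟩, Set.mem_iUnion.2 ⟨i, ?_⟩⟩
          simp only [hB]
          rw [if_pos ⟨hnt, trivial⟩]
          exact ⟨x, hxV, rfl⟩
      · left
        refine Set.mem_iUnion.2 ⟨i, ?_⟩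
        simp only [hZ, if_neg hnt]
        exact ⟨x, hxV, rfl⟩
    have hPZ : ∀ i, P (Z i) = 0 := by
      intro i
      have hsub : (Z i).Subsingleton := by
        simp only [hZ]
        split_ifs with h
        · exact Set.subsingleton_empty
        · exact (Set.not_nontrivial_iff.1 h).image g
      have h0 : ediam (Z i) = 0 := ediam_subsingleton hsub
      have := OuterMeasure.mkMetric'.pre_le (m := fun s : Set X => ediam s ^ u) (r := ρ)
        (s := Z i) (by rw [h0]; exact zero_le)
      rw [h0, ENNReal.zero_rpow_of_pos hu] at this
      exact le_antisymm this zero_le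
    calc P (g '' A) ≤ P (⋃ i, Z i) + P (⋃ k, ⋃ q, J k q) :=
          (measure_mono hcov).trans (measure_union_le _ _)
      _ ≤ (∑' i, P (Z i)) + ∑' k, ∑' q, P (J k q) := by
          gcongr
          · exact measure_iUnion_le _
          · exact (measure_iUnion_le _).trans (ENNReal.tsum_le_tsum fun k => measure_iUnion_le _)
      _ = ∑' k, ∑' q, P (J k q) := by simp [hPZ]
      _ ≤ _ := by
          refine ENNReal.tsum_le_tsum fun k => ENNReal.tsum_le_tsum fun q => ?_
          by_cases h : q ∈ cubeIdx (ℓ k) '' A ∧ q ∈ ⋃ i, B k i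
          · rw [Set.indicator_of_mem h.1, Set.indicator_of_mem h.2]
            simp only [hJ, if_pos h]
            obtain ⟨i, hi⟩ := Set.mem_iUnion.1 h.2
            exact OuterMeasure.mkMetric'.pre_le
              (((hBd k i q hi).trans (mul_le_mul' le_rfl (hUd i))).trans hρ')
          · simp only [hJ, if_neg h, measure_empty, zero_le]
  · have hterm : ∀ i, ∑' q, (B k i).indicator (fun _ => (c * ediam (U i)) ^ t) q ≤
        N * c ^ t * ⨆ _ : (U i).Nonempty, ediam (U i) ^ t := by
      intro i
      rw [← tsum_subtype, ENNReal.tsum_set_const]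
      simp only [hB]
      split_ifs with h
      · obtain ⟨hnt, rfl⟩ := h
        have hne : (U i).Nonempty := hnt.nonempty.elim fun x hx => ⟨g x, hx.2⟩
        rw [ENNReal.mul_rpow_of_nonneg _ _ ht.le, ← mul_assoc, iSup_pos hne]
        gcongr
        exact_mod_cast hκN _ (hVT i) hnt
      · simp
    calc ∑' q, (⋃ i, B k i).indicator (fun q => d k q ^ t) q
        ≤ ∑' q, ∑' i, (B k i).indicator (fun _ => (c * ediam (U i)) ^ t) q := by
          refine ENNReal.tsum_le_tsum fun q => ?_
          by_cases h : q ∈ ⋃ i, B k i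
          · rw [Set.indicator_of_mem h]
            obtain ⟨i, hi⟩ := Set.mem_iUnion.1 h
            refine le_trans ?_ (ENNReal.le_tsum i)
            rw [Set.indicator_of_mem hi]
            exact ENNReal.rpow_le_rpow (hBd k i q hi) ht.le
          · simp [Set.indicator_of_notMem h]
      _ = ∑' i, ∑' q, (B k i).indicator (fun _ => (c * ediam (U i)) ^ t) q := ENNReal.tsum_comm
      _ ≤ ∑' i, N * c ^ t * ⨆ _ : (U i).Nonempty, ediam (U i) ^ t := ENNReal.tsum_le_tsum hterm
      _ ≤ N * c ^ t * ε' := by rw [ENNReal.tsum_mul_left]; exact mul_le_mul' le_rfl hUsum.le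
      _ ≤ ε := hε'

theorem maximal_lower_scaling {L r α γ b c V : ℝ} (hL : 0 < L) (hr : 0 < r) (hb : 0 ≤ b) :
    c * L ^ (α * γ / (2 * (1 + 1 / r))) * (L / 2 / V) *
        (b * L ^ (α * γ / (2 * (1 + 1 / r)))) ^ (1 / r) =
      c * b ^ (1 / r) / (2 * V) * L ^ (1 + α * γ / 2) := by
  set β := α * γ / (2 * (1 + 1 / r)) with hβ
  have hsum : 1 + α * γ / 2 = β + 1 + β * (1 / r) := by
    rw [hβ]; field_simp; ring
  rw [Real.mul_rpow hb (by positivity), ← Real.rpow_mul hL.le, hsum, Real.rpow_add hL,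
    Real.rpow_add hL, Real.rpow_one]
  ring

theorem maximal_upper_scaling {n : ℕ} {L s t u α C D ε : ℝ} (hL : 0 < L) (hs : 0 < s)
    (hD : 0 < D) (hε : 0 ≤ ε) :
    C * (L / 2) ^ (-((n - s) / s) - α * ((u * s - t) / s) / 2) *
        ((D * L ^ α) ^ (u * s - t) * ε * (L / 2 / (2 * n)) ^ n) ^ (1 / s) =
      C * (1 / 2) ^ (-((n - s) / s) - α * ((u * s - t) / s) / 2) *
        (D ^ (u * s - t) * (1 / (4 * n)) ^ n) ^ (1 / s) * ε ^ (1 / s) *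
          L ^ (1 + α * ((u * s - t) / s) / 2) := by
  have e1 : L / 2 / (2 * n) = 1 / (4 * n) * L := by ring
  have e2 : (L / 2) = 1 / 2 * L := by ring
  have hsum : 1 + α * ((u * s - t) / s) / 2 = (-((n - s) / s) - α * ((u * s - t) / s) / 2) +
      α * (u * s - t) * (1 / s) + n * (1 / s) := by
    field_simp; ring
  rw [e1, e2, Real.mul_rpow (by norm_num) hL.le, Real.mul_rpow hD.le (by positivity), mul_pow,
    show D ^ (u * s - t) * (L ^ α) ^ (u * s - t) * ε * ((1 / (4 * n)) ^ n * L ^ n) =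
      (D ^ (u * s - t) * (1 / (4 * n)) ^ n) * ε * ((L ^ α) ^ (u * s - t)) * L ^ n by ring,
    Real.mul_rpow (by positivity) (by positivity), Real.mul_rpow (by positivity) (by positivity),
    Real.mul_rpow (by positivity) (by positivity), ← Real.rpow_natCast L n, ← Real.rpow_mul hL.le,
    ← Real.rpow_mul hL.le, ← Real.rpow_mul hL.le, hsum, Real.rpow_add hL, Real.rpow_add hL]
  ring

/-- Positive Hausdorff measure gives a quantitative lower bound for the contents at fine scales. -/
theorem eventually_inv_le_pre {X : Type*} [MetricSpace X] [MeasurableSpace X] [BorelSpace X]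
    {u : ℝ} {S : Set X} (h : 0 < μH[u] S) :
    ∀ᶠ m : ℕ in Filter.atTop, (m : ℝ≥0∞)⁻¹ ≤
      OuterMeasure.mkMetric'.pre (fun s : Set X => ediam s ^ u) (m : ℝ≥0∞)⁻¹ S := by
  have hE : μH[u] S = OuterMeasure.mkMetric' (fun s : Set X => ediam s ^ u) S := by
    rw [Measure.hausdorffMeasure, ← Measure.coe_toOuterMeasure, Measure.mkMetric_toOuterMeasure]
    rfl
  obtain ⟨b, hb0, hb⟩ := exists_between h
  rw [hE] at hb
  filter_upwards [(OuterMeasure.mkMetric'.tendsto_pre_nat _ S).eventually_const_lt hb,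
    ENNReal.tendsto_inv_nat_nhds_zero.eventually_lt_const hb0] with m h1 h2
  exact (h2.trans h1).le

theorem exists_mem_seg_dist_eq {n : ℕ} {e x y : EuclideanSpace ℝ (Fin n)} (he : ‖e‖ = 1)
    (hy : y ∈ seg e x) {ρ : ℝ} (hρ : ρ ∈ Set.Icc (0 : ℝ) (1 / 2)) :
    ∃ z ∈ seg e x, dist y z = ρ := by
  obtain ⟨t, ht, rfl⟩ := hy
  obtain ⟨τ, hτ, hd⟩ : ∃ τ ∈ Set.Icc (0 : ℝ) 1, |t - τ| = ρ := by
    rcases le_total t (1 / 2) with h | h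
    · refine ⟨t + ρ, ⟨by linarith [ht.1, hρ.1], by linarith [hρ.2]⟩, ?_⟩
      rw [show t - (t + ρ) = -ρ by ring, abs_neg, abs_of_nonneg hρ.1]
    · refine ⟨t - ρ, ⟨by linarith [hρ.2], by linarith [ht.2, hρ.1]⟩, ?_⟩
      rw [show t - (t - ρ) = ρ by ring, abs_of_nonneg hρ.1]
  refine ⟨_, ⟨τ, hτ, rfl⟩, ?_⟩
  rw [dist_add_left, dist_eq_norm, ← sub_smul, norm_smul, he, mul_one, Real.norm_eq_abs, hd]

theorem norm_le_of_mem_seg {n : ℕ} {e x y : EuclideanSpace ℝ (Fin n)} (he : ‖e‖ = 1)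
    (hy : y ∈ seg e x) : ‖y‖ ≤ ‖x‖ + 1 := by
  obtain ⟨t, ht, rfl⟩ := hy
  refine (norm_add_le _ _).trans ?_
  rw [norm_smul, he, mul_one, Real.norm_of_nonneg ht.1]
  linarith [ht.2]

/-- The main estimate, for a family `A` of directions whose segments lie in a bounded part of `K`
and whose images have `u`-content bounded below: the image of the union of these segments is not
`μH[t]`-null for `t < s * u`. -/
theorem hausdorffMeasure_image_ne_zero {n : ℕ} (hn : 0 < n) {u r s t M : ℝ} (hu : 0 < u)
    (hr : 0 < r) (hs : 0 < s) (ht : 0 < t) (htsu : t < s * u)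
    {μ : Measure (EuclideanSpace ℝ (Fin n))}
    (hyp : ∀ ε > (0 : ℝ), ∃ C > (0 : ℝ), ∀ δ ∈ Set.Ioo (0 : ℝ) 1,
      ∀ f : EuclideanSpace ℝ (Fin n) → ℝ, Measurable f →
        (∫⁻ e in sphere (0 : EuclideanSpace ℝ (Fin n)) 1, (kakeyaMax δ f e) ^ r ∂μ) ^ (1 / r) ≤
          ENNReal.ofReal (C * δ ^ (-(((n : ℝ) - s) / s) - ε)) *
            (∫⁻ y, ENNReal.ofReal |f y| ^ s) ^ (1 / s))
    {X : Type*} [MetricSpace X] [MeasurableSpace X] [BorelSpace X]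
    {g : EuclideanSpace ℝ (Fin n) → X} {η : ℝ → ℝ} (hη : IsQSGauge η)
    {A : Set (EuclideanSpace ℝ (Fin n))} (hA : A ⊆ sphere 0 1) (hApos : μ A ≠ 0)
    {p : EuclideanSpace ℝ (Fin n) → EuclideanSpace ℝ (Fin n)} (hp : ∀ e ∈ A, ‖p e‖ ≤ M)
    (hqs : IsQSOn η g (⋃ e ∈ A, seg e (p e))) {ρ : ℝ≥0∞} (hρ : ρ ≠ 0) {c : ℝ} (hc : 0 < c)
    (hcont : ∀ e ∈ A, ENNReal.ofReal c ≤
      OuterMeasure.mkMetric'.pre (fun s : Set X => ediam s ^ u) ρ (g '' seg e (p e))) :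
    μH[t] (g '' ⋃ e ∈ A, seg e (p e)) ≠ 0 := by
  intro hnull
  set T := ⋃ e ∈ A, seg e (p e) with hT
  have hn' : (0 : ℝ) < n := by exact_mod_cast hn
  have hnorm : ∀ e ∈ A, ‖e‖ = 1 := fun e he => mem_sphere_zero_iff_norm.1 (hA he)
  have hTR : ∀ x ∈ T, ∀ y ∈ T, dist x y ≤ 2 * (|M| + 1) := by
    have hb : ∀ x ∈ T, ‖x‖ ≤ |M| + 1 := by
      intro x hx
      obtain ⟨e, he, hx⟩ := Set.mem_iUnion₂.1 hx
      linarith [norm_le_of_mem_seg (hnorm e he) hx, hp e he, le_abs_self M]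
    intro x hx y hy
    linarith [dist_le_norm_add_norm x y, hb x hx, hb y hy]
  have hperf : ∀ x ∈ T, ∀ ρ ∈ Set.Icc (0 : ℝ) (1 / 2), ∃ y ∈ T, dist x y = ρ := by
    intro x hx ρ hρ
    obtain ⟨e, he, hx⟩ := Set.mem_iUnion₂.1 hx
    obtain ⟨y, hy, hxy⟩ := exists_mem_seg_dist_eq (hnorm e he) hx hρ
    exact ⟨y, Set.mem_iUnion₂.2 ⟨e, he, hy⟩, hxy⟩
  obtain ⟨l, hl, D, hD, hmod⟩ := hqs.exists_geometric_modulus hη hTR hperf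
  obtain ⟨C, N, hscale⟩ := hqs.exists_scale hη hTR (by positivity) hl
    (show (0 : ℝ) < 1 / (4 * n) by positivity)
  obtain ⟨hl0, hl1⟩ := hl
  set α := Real.logb l (1 / 2) with hα
  have hα0 : 0 < α := Real.logb_pos_of_base_lt_one hl0 hl1 (by norm_num) (by norm_num)
  have hlα : l ^ α = 1 / 2 := Real.rpow_logb hl0 hl1.ne (by norm_num)
  set γ := (u * s - t) / s with hγ
  have hust : 0 < u * s - t := by linarith [mul_comm s u]
  have hγ0 : 0 < γ := by positivity
  set β := α * γ / (2 * (1 + 1 / r)) with hβ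
  have hβ0 : 0 < β := by positivity
  set σ := l ^ β with hσ
  have hσ0 : 0 < σ := by positivity
  have hσ1 : σ < 1 := Real.rpow_lt_one hl0.le hl1 hβ0
  have h1σ : 0 < 1 - σ := by linarith
  obtain ⟨Cm, hCm, hmax⟩ := hyp (α * γ / 2) (by positivity)
  obtain ⟨Cv, hCv, hvol⟩ := exists_volume_tube_le n
  obtain ⟨b, hb0, hbA⟩ : ∃ b : ℝ, 0 < b ∧ ENNReal.ofReal b ≤ μ A := by
    refine ⟨(min (μ A) 1).toReal, ENNReal.toReal_pos ?_ (by simp), ?_⟩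
    · exact (lt_min (pos_iff_ne_zero.2 hApos) one_pos).ne'
    · exact ENNReal.ofReal_toReal_le.trans (min_le_left _ _)
  set b₁ := b / 2 * (1 - σ) with hb₁
  set c₁ := c / 2 * (1 - σ) with hc₁
  have hb₁0 : 0 < b₁ := by positivity
  have hc₁0 : 0 < c₁ := by positivity
  set V := Cv * (2 * n : ℝ) ^ n with hV
  have hV0 : 0 < V := by positivity
  set M₁ := c₁ * b₁ ^ (1 / r) / (2 * V) with hM₁
  have hM₁0 : 0 < M₁ := by positivity
  set M₂ := Cm * (1 / 2) ^ (-(((n : ℝ) - s) / s) - α * γ / 2) *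
    (D ^ (u * s - t) * (1 / (4 * n)) ^ n) ^ (1 / s) with hM₂
  have hM₂0 : 0 < M₂ := by positivity
  set ε := (M₁ / (2 * M₂)) ^ s with hε
  have hε0 : 0 < ε := by positivity
  obtain ⟨Q, hQcov, hQsum⟩ := exists_cube_family (ρ := ρ) (ε := ENNReal.ofReal ε)
    (ℓ := fun k => 1 / (4 * n) * l ^ k) ht hu hnull hscale hρ (by simpa using hε0)
  set d : ℕ → (Fin n → ℤ) → ℝ≥0∞ := fun k q =>
    ediam (g '' (T ∩ cubeIdx (1 / (4 * n) * l ^ k) ⁻¹' {q})) with hd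
  have hdle : ∀ k q, d k q ≤ ENNReal.ofReal (D * (1 / 2) ^ k) := by
    intro k q
    refine ediam_le ?_
    rintro _ ⟨x, ⟨hxT, hxq⟩, rfl⟩ _ ⟨y, ⟨hyT, hyq⟩, rfl⟩
    rw [edist_dist]
    refine ENNReal.ofReal_le_ofReal (hmod k x hxT y hyT ?_)
    refine (dist_le_of_cubeIdx_eq (by positivity)
      (show cubeIdx (1 / (4 * n) * l ^ k) x = _ from hxq.trans hyq.symm)).trans ?_
    have : 0 < l ^ k := by positivity
    rw [show n * (1 / (4 * n) * l ^ k) = l ^ k / 4 by field_simp]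
    linarith
  set w : ℕ → (Fin n → ℤ) → ℝ≥0∞ := fun k => (Q k).indicator fun q => d k q ^ u with hw
  set Ak : ℕ → Set (EuclideanSpace ℝ (Fin n)) := fun k =>
    {e ∈ A | ENNReal.ofReal (c₁ * σ ^ k) ≤
      ∑' q, (cubeIdx (1 / (4 * n) * l ^ k) '' seg e (p e)).indicator (w k) q} with hAk
  have hAcov : A ⊆ ⋃ k, Ak k := by
    intro e he
    have hsub : seg e (p e) ⊆ T := Set.subset_biUnion_of_mem (u := fun e => seg e (p e)) he
    obtain ⟨k, hk⟩ := exists_geometric_lt_of_le_tsum hσ0 hσ1 hc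
      ((hcont e he).trans (hQcov _ hsub))
    exact Set.mem_iUnion.2 ⟨k, he, hk.le⟩
  obtain ⟨k, hk⟩ := exists_geometric_lt_of_le_tsum hσ0 hσ1 hb0
    (hbA.trans ((measure_mono hAcov).trans (measure_iUnion_le _)))
  set L := l ^ k with hL
  have hL0 : 0 < L := by positivity
  have hL1 : L ≤ 1 := pow_le_one₀ hl0.le hl1.le
  have hσk : σ ^ k = L ^ β := by
    rw [hσ, hL, ← Real.rpow_natCast, ← Real.rpow_natCast, ← Real.rpow_mul hl0.le,
      ← Real.rpow_mul hl0.le, mul_comm]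
  have hhalf : (1 / 2 : ℝ) ^ k = L ^ α := by
    rw [← hlα, hL, ← Real.rpow_natCast, ← Real.rpow_natCast, ← Real.rpow_mul hl0.le,
      ← Real.rpow_mul hl0.le, mul_comm]
  have hside : L / 2 / (2 * n) = 1 / (4 * n) * L := by ring
  have hwfin : ∀ q, w k q ≠ ∞ := by
    intro q
    refine ne_top_of_le_ne_top ?_ (Set.indicator_le_self _ _ q)
    exact ENNReal.rpow_ne_top_of_nonneg hu.le (ne_top_of_le_ne_top ENNReal.ofReal_ne_top (hdle k q))
  have hδ : L / 2 ∈ Set.Ioo (0 : ℝ) 1 := ⟨by positivity, by linarith⟩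
  have hmain := discrete_maximal_inequality hn hCv hδ.1 hr (hvol _ hδ) (hmax _ hδ) hwfin
    (c := ENNReal.ofReal (c₁ * σ ^ k)) (A := Ak k) (fun e he => hA he.1)
    (fun e he => ⟨p e, by rw [hside]; exact he.2⟩)
  have hwsum : ∑' q, w k q ^ s ≤ ENNReal.ofReal ((D * L ^ α) ^ (u * s - t) * ε) := by
    have hDL : 0 < D * L ^ α := by positivity
    calc ∑' q, w k q ^ s
        ≤ ∑' q, ENNReal.ofReal ((D * L ^ α) ^ (u * s - t)) *
            (Q k).indicator (fun q => d k q ^ t) q := by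
          refine ENNReal.tsum_le_tsum fun q => ?_
          by_cases hq : q ∈ Q k
          · simp only [hw, Set.indicator_of_mem hq]
            rw [← ENNReal.rpow_mul, show u * s = (u * s - t) + t by ring,
              ENNReal.rpow_add_of_nonneg _ _ hust.le ht.le,
              ← ENNReal.ofReal_rpow_of_pos hDL, ← hhalf, add_sub_cancel_right]
            gcongr
            exact hdle k q
          · simp [hw, Set.indicator_of_notMem hq, hs]
      _ ≤ _ := by
          rw [ENNReal.tsum_mul_left, ENNReal.ofReal_mul (by positivity)]
          exact mul_le_mul' le_rfl (hQsum k)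
  have hreal : c₁ * σ ^ k * (L / 2 / V) * (b₁ * σ ^ k) ^ (1 / r) ≤
      Cm * (L / 2) ^ (-(((n : ℝ) - s) / s) - α * γ / 2) *
        ((D * L ^ α) ^ (u * s - t) * ε * (L / 2 / (2 * n)) ^ n) ^ (1 / s) := by
    have hnonneg : 0 ≤ (D * L ^ α) ^ (u * s - t) * ε := by positivity
    rw [← ENNReal.ofReal_le_ofReal_iff (by positivity),
      ENNReal.ofReal_mul (p := c₁ * σ ^ k * (L / 2 / V)) (by positivity),
      ENNReal.ofReal_mul (p := c₁ * σ ^ k) (by positivity),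
      ENNReal.ofReal_mul (p := Cm * (L / 2) ^ (-(((n : ℝ) - s) / s) - α * γ / 2)) (by positivity),
      ← ENNReal.ofReal_rpow_of_nonneg (by positivity) (by positivity),
      ← ENNReal.ofReal_rpow_of_nonneg (by positivity) (by positivity),
      ENNReal.ofReal_mul hnonneg]
    refine le_trans ?_ (hmain.trans ?_)
    · gcongr
    · gcongr
  rw [hσk, maximal_lower_scaling hL0 hr hb₁0.le,
    maximal_upper_scaling hL0 hs hD hε0.le] at hreal
  have hfin : M₁ ≤ M₂ * ε ^ (1 / s) := le_of_mul_le_mul_right hreal (by positivity)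
  rw [hε, ← Real.rpow_mul (by positivity), mul_one_div_cancel hs.ne', Real.rpow_one,
    show M₂ * (M₁ / (2 * M₂)) = M₁ / 2 by field_simp] at hfin
  linarith

/-- Main theorem: an `L^s → L^r` Kakeya maximal inequality with exponent `-(n-s)/s - ε`
implies `dim_H g(K) ≥ su` for quasisymmetric images of Kakeya sets distorting a
positive-measure family of segments to positive `H^u`-measure. -/
theorem stmt14 {n : ℕ} (hn : 2 ≤ n) (u r s : ℝ) (hu : 1 ≤ u) (hr : 0 < r)
    (hs1 : 1 < s) (hsn : s ≤ n)
    (hyp : ∀ ε > (0:ℝ), ∃ C > (0:ℝ), ∀ δ ∈ Set.Ioo (0:ℝ) 1,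
      ∀ f : EuclideanSpace ℝ (Fin n) → ℝ, Measurable f →
        (∫⁻ e in Metric.sphere (0 : EuclideanSpace ℝ (Fin n)) 1,
            (kakeyaMax δ f e) ^ r ∂(μH[((n : ℝ) - 1)])) ^ (1 / r) ≤
          ENNReal.ofReal (C * δ ^ (-(((n : ℝ) - s) / s) - ε)) *
            (∫⁻ y, ENNReal.ofReal |f y| ^ s) ^ (1 / s))
    {X : Type*} [MetricSpace X] [MeasurableSpace X] [BorelSpace X]
    (K S : Set (EuclideanSpace ℝ (Fin n)))
    (hS : S ⊆ Metric.sphere (0 : EuclideanSpace ℝ (Fin n)) 1)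
    (hSpos : 0 < μH[((n : ℝ) - 1)] S)
    (hKak : ∀ e ∈ S, ∃ x, seg e x ⊆ K)
    (g : EuclideanSpace ℝ (Fin n) → X) (η : ℝ → ℝ)
    (hη : IsQSGauge η) (hqs : IsQSOn η g K) (hinj : Set.InjOn g K)
    (hline : 0 < μH[((n : ℝ) - 1)]
      {e ∈ Metric.sphere (0 : EuclideanSpace ℝ (Fin n)) 1 |
        ∃ x, seg e x ⊆ K ∧ 0 < μH[u] (g '' seg e x)}) :
    ENNReal.ofReal (s * u) ≤ dimH (g '' K) := by
  by_contra! hlt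
  obtain ⟨t, hdt, htsu⟩ := ENNReal.lt_iff_exists_nnreal_btwn.1 hlt
  have ht : (0 : ℝ) < t := by exact_mod_cast (zero_le.trans_lt hdt : (0 : ℝ≥0∞) < t)
  have hts : (t : ℝ) < s * u := by
    rw [← ENNReal.ofReal_coe_nnreal] at htsu
    exact (ENNReal.ofReal_lt_ofReal_iff_of_nonneg t.2).1 htsu
  have hnull : μH[t] (g '' K) = 0 := hausdorffMeasure_of_dimH_lt hdt
  set A : ℕ → Set (EuclideanSpace ℝ (Fin n)) := fun m =>
    {e ∈ sphere (0 : EuclideanSpace ℝ (Fin n)) 1 | ∃ x, seg e x ⊆ K ∧ ‖x‖ ≤ m ∧ 1 ≤ m ∧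
      (m : ℝ≥0∞)⁻¹ ≤ OuterMeasure.mkMetric'.pre (fun s : Set X => ediam s ^ u) (m : ℝ≥0∞)⁻¹
        (g '' seg e x)} with hA
  have hcov : {e ∈ sphere (0 : EuclideanSpace ℝ (Fin n)) 1 |
      ∃ x, seg e x ⊆ K ∧ 0 < μH[u] (g '' seg e x)} ⊆ ⋃ m, A m := by
    rintro e ⟨he, x, hxK, hx⟩
    obtain ⟨m, h1, h2, h3⟩ := ((eventually_inv_le_pre hx).and
      ((Filter.eventually_ge_atTop 1).and
        (tendsto_natCast_atTop_atTop.eventually_ge_atTop ‖x‖))).exists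
    exact Set.mem_iUnion.2 ⟨m, he, x, hxK, h3, h2, h1⟩
  obtain ⟨m, hm⟩ := exists_measure_pos_of_not_measure_iUnion_null
    (hline.trans_le (measure_mono hcov)).ne'
  have hex : ∀ e ∈ A m, ∃ x, seg e x ⊆ K ∧ ‖x‖ ≤ m ∧ 1 ≤ m ∧
      (m : ℝ≥0∞)⁻¹ ≤ OuterMeasure.mkMetric'.pre (fun s : Set X => ediam s ^ u) (m : ℝ≥0∞)⁻¹
        (g '' seg e x) := fun e he => he.2
  choose! p hpK hpm hm1 hcont using hex
  obtain ⟨e₀, he₀⟩ := nonempty_of_measure_ne_zero hm.ne'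
  have hm0 : (0 : ℝ) < m := by exact_mod_cast hm1 e₀ he₀
  have hTK : (⋃ e ∈ A m, seg e (p e)) ⊆ K := Set.iUnion₂_subset hpK
  refine hausdorffMeasure_image_ne_zero (by omega) (by linarith) hr (by linarith) ht hts hyp hη
    (fun e he => he.1) hm.ne' hpm
    (fun x hx y hy z hz => hqs x (hTK hx) y (hTK hy) z (hTK hz))
    (ENNReal.inv_ne_zero.2 (ENNReal.natCast_ne_top m)) (inv_pos.2 hm0) (fun e he => ?_)
    (measure_mono_null (Set.image_mono hTK) hnull)
  rw [ENNReal.ofReal_inv_of_pos hm0, ENNReal.ofReal_natCast]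
  exact hcont e he
end
end

section
/- Assume the Kakeya maximal function estimate of Wolff: inequality $\|M_\delta f\|_{L^r(S^{n-1})} \leq C(\epsilon)\delta^{-(n-s)/s-\epsilon}\|f\|_{L^s(\mathbb{R}^n)}$ with $s = (n+2)/2$ and $r = (n-1)(n+2)/n$. Then if $K \subset \mathbb{R}^n$ is a Kakeya set, $(X,d)$ is a metric space with $\dim_{\mathrm{H}} X \leq n$, and $g \colon K \to X$ is a quasisymmetric homeomorphism, then for $\mathcal{H}^{n-1}$-almost every direction $e$, every unit line segment $L_e(x) \subset K$ satisfies $\dim_{\mathrm{H}} g(L_e(x)) \leq 2n/(n+2)$. -/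
open Set Metric MeasureTheory ENNReal

noncomputable section

/-- The index of the half-open grid cube of side `σ` containing `y`. -/
def cellIdx {n : ℕ} (σ : ℝ) (y : EuclideanSpace ℝ (Fin n)) : Fin n → ℤ := fun i => ⌊y i / σ⌋

lemma measurable_cellIdx {n : ℕ} (σ : ℝ) :
    Measurable (cellIdx σ : EuclideanSpace ℝ (Fin n) → Fin n → ℤ) := by
  refine measurable_pi_lambda _ fun i => ?_
  unfold cellIdx
  fun_prop

lemma volume_cellIdx_preimage {n : ℕ} {σ : ℝ} (hσ : 0 < σ) (m : Fin n → ℤ) :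
    volume ((cellIdx σ : EuclideanSpace ℝ (Fin n) → Fin n → ℤ) ⁻¹' {m}) =
      ENNReal.ofReal (σ ^ n) := by
  have h : (cellIdx σ : EuclideanSpace ℝ (Fin n) → Fin n → ℤ) ⁻¹' {m} =
      (WithLp.ofLp : EuclideanSpace ℝ (Fin n) → Fin n → ℝ) ⁻¹'
        (Set.pi Set.univ fun i => Set.Ico ((m i : ℝ) * σ) ((m i : ℝ) * σ + σ)) := by
    ext y
    simp only [Set.mem_preimage, Set.mem_singleton_iff, funext_iff, cellIdx, Int.floor_eq_iff,
      Set.mem_pi, Set.mem_univ, true_imp_iff, Set.mem_Ico, le_div_iff₀ hσ, div_lt_iff₀ hσ, add_mul,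
      one_mul]
  rw [h, (PiLp.volume_preserving_ofLp (Fin n)).measure_preimage
    (MeasurableSet.univ_pi fun i => measurableSet_Ico).nullMeasurableSet, volume_pi_pi]
  simp [Real.volume_Ico, ENNReal.ofReal_pow hσ.le]

lemma lintegral_comp_cellIdx {n : ℕ} {σ : ℝ} (hσ : 0 < σ) (F : (Fin n → ℤ) → ℝ≥0∞) :
    ∫⁻ y : EuclideanSpace ℝ (Fin n), F (cellIdx σ y) = (∑' m, F m) * ENNReal.ofReal (σ ^ n) := by
  rw [← lintegral_map (f := F) (measurable_of_countable F) (measurable_cellIdx σ),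
    lintegral_countable', ← ENNReal.tsum_mul_right]
  refine tsum_congr fun m => ?_
  rw [Measure.map_apply (measurable_cellIdx σ) (measurableSet_singleton m),
    volume_cellIdx_preimage hσ]

lemma dist_le_of_abs_cellIdx_sub_le {n : ℕ} {σ T : ℝ} (hσ : 0 < σ)
    {y z : EuclideanSpace ℝ (Fin n)}
    (h : ∀ i, |((cellIdx σ y i : ℤ) : ℝ) - cellIdx σ z i| ≤ T) :
    dist y z ≤ n * ((T + 1) * σ) := by
  have h1 : ∀ i, ‖(y - z) i‖ ≤ (T + 1) * σ := fun i => by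
    have a1 := Int.floor_le (y i / σ)
    have a2 := Int.lt_floor_add_one (y i / σ)
    have b1 := Int.floor_le (z i / σ)
    have b2 := Int.lt_floor_add_one (z i / σ)
    have hi := abs_le.1 (h i)
    simp only [cellIdx] at hi
    have : |y i / σ - z i / σ| ≤ T + 1 := abs_le.2 ⟨by linarith, by linarith⟩
    rw [← sub_div, abs_div, abs_of_pos hσ, div_le_iff₀ hσ] at this
    simpa using this
  rw [dist_eq_norm]
  have h2 : ‖y - z‖ ≤ ∑ i, ‖(y - z) i‖ := by
    rw [EuclideanSpace.norm_eq]
    refine Real.sqrt_le_iff.2 ⟨by positivity, ?_⟩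
    exact Finset.sum_sq_le_sq_sum_of_nonneg fun i _ => norm_nonneg _
  refine h2.trans ((Finset.sum_le_sum fun i _ => h1 i).trans ?_)
  simp

lemma abs_cellIdx_sub_le {n : ℕ} {σ : ℝ} (hσ : 0 < σ) (y z : EuclideanSpace ℝ (Fin n)) (i : Fin n) :
    |((cellIdx σ y i : ℤ) : ℝ) - cellIdx σ z i| ≤ dist y z / σ + 1 := by
  have a1 := Int.floor_le (y i / σ)
  have a2 := Int.lt_floor_add_one (y i / σ)
  have b1 := Int.floor_le (z i / σ)
  have b2 := Int.lt_floor_add_one (z i / σ)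
  have h : |y i - z i| ≤ dist y z := by
    rw [dist_eq_norm]; exact PiLp.norm_apply_le (y - z) i
  have h2 : |y i / σ - z i / σ| ≤ dist y z / σ := by
    rw [← sub_div, abs_div, abs_of_pos hσ]; gcongr
  have h3 := abs_le.1 h2
  simp only [cellIdx]
  exact abs_le.2 ⟨by linarith, by linarith⟩

lemma dist_le_of_cellIdx_eq {n : ℕ} {σ : ℝ} (hσ : 0 < σ) {y z : EuclideanSpace ℝ (Fin n)}
    (h : cellIdx σ y = cellIdx σ z) : dist y z ≤ n * σ := by
  simpa using dist_le_of_abs_cellIdx_sub_le (T := 0) hσ (by simp [h])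

lemma volume_tube_le (n : ℕ) : ∃ V > (0:ℝ), ∀ δ ∈ Set.Ioo (0:ℝ) 1,
    ∀ e ∈ Metric.sphere (0 : EuclideanSpace ℝ (Fin n)) 1, ∀ x,
      volume (tube δ e x) ≤ ENNReal.ofReal (V * δ ^ n / δ) := by
  set B := (volume (Metric.ball (0 : EuclideanSpace ℝ (Fin n)) 1)).toReal with hB
  have hB0 : 0 ≤ B := ENNReal.toReal_nonneg
  have hBe : volume (Metric.ball (0 : EuclideanSpace ℝ (Fin n)) 1) = ENNReal.ofReal B :=
    (ENNReal.ofReal_toReal measure_ball_lt_top.ne).symm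
  refine ⟨3 * (3 ^ n * (B + 1)), by positivity, fun δ hδ e he x => ?_⟩
  obtain ⟨h0, h1⟩ := hδ
  have he' : ‖e‖ = 1 := by simpa using he
  set N := ⌊1 / δ⌋₊ + 1 with hN
  have hsub : tube δ e x ⊆ ⋃ j ∈ Finset.range N, Metric.closedBall (x + ((j:ℝ) * δ) • e) (3 * δ) := by
    intro y hy
    have hy' := Metric.cthickening_subset_thickening' (by positivity) (by linarith : δ < 2 * δ) _ hy
    obtain ⟨z, ⟨t, ⟨ht0, ht1⟩, rfl⟩, hz⟩ := Metric.mem_thickening_iff.1 hy'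
    have hj1 := Nat.floor_le (div_nonneg ht0 h0.le)
    have hj2 := Nat.lt_floor_add_one (t / δ)
    rw [le_div_iff₀ h0] at hj1
    rw [div_lt_iff₀ h0] at hj2
    refine Set.mem_biUnion (x := ⌊t / δ⌋₊) ?_ ?_
    · simp only [Finset.coe_range, Set.mem_Iio, hN, Nat.lt_succ_iff]
      exact Nat.floor_le_floor (by gcongr)
    · refine (dist_triangle y (x + t • e) _).trans ?_
      have : dist (x + t • e) (x + ((⌊t / δ⌋₊ : ℝ) * δ) • e) ≤ δ := by
        rw [dist_add_left, dist_eq_norm, ← sub_smul, norm_smul, he', mul_one, Real.norm_eq_abs]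
        exact abs_le.2 ⟨by linarith, by linarith⟩
      linarith
  have hNle : (N : ℝ) ≤ 2 / δ := by
    have := Nat.floor_le (div_nonneg zero_le_one h0.le)
    have h1' : 1 ≤ 1 / δ := by rw [le_div_iff₀ h0]; linarith
    have h2' : 2 / δ = 1 / δ + 1 / δ := by ring
    push_cast [hN]; linarith
  refine (measure_mono hsub).trans ((measure_biUnion_finset_le _ _).trans ?_)
  simp only [Measure.addHaar_closedBall volume _ (by positivity : 0 ≤ 3 * δ), hBe, finrank_euclideanSpace,
    Fintype.card_fin, Finset.sum_const, Finset.card_range, nsmul_eq_mul]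
  rw [← ENNReal.ofReal_mul (by positivity), ← ENNReal.ofReal_natCast, ← ENNReal.ofReal_mul (by positivity)]
  refine ENNReal.ofReal_le_ofReal ?_
  calc (N : ℝ) * ((3 * δ) ^ n * B) ≤ 2 / δ * ((3 * δ) ^ n * B) := by gcongr
    _ = (2 * (3 ^ n * B)) * δ ^ n / δ := by rw [mul_pow]; ring
    _ ≤ 3 * (3 ^ n * (B + 1)) * δ ^ n / δ := by gcongr <;> linarith

lemma mem_tube_of_cellIdx_eq {n : ℕ} (hn : 0 < n) {δ : ℝ} (hδ : 0 < δ)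
    {e e' x y z : EuclideanSpace ℝ (Fin n)} (hee : dist e' e ≤ δ / 2) (hz : z ∈ seg e x)
    (hyz : cellIdx (δ / (2 * n)) y = cellIdx (δ / (2 * n)) z) : y ∈ tube δ e' x := by
  have hn' : (0:ℝ) < n := by exact_mod_cast hn
  obtain ⟨t, ⟨ht0, ht1⟩, rfl⟩ := hz
  refine Metric.mem_cthickening_of_dist_le y (x + t • e') δ _ ⟨t, ⟨ht0, ht1⟩, rfl⟩ ?_
  have h1 := dist_le_of_cellIdx_eq (by positivity) hyz
  have h2 : dist (x + t • e) (x + t • e') ≤ δ / 2 := by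
    rw [dist_add_left, dist_comm, dist_eq_norm, ← smul_sub, norm_smul, Real.norm_of_nonneg ht0,
      ← dist_eq_norm]
    exact (mul_le_of_le_one_left dist_nonneg ht1).trans hee
  have h3 : n * (δ / (2 * n)) = δ / 2 := by field_simp
  have := dist_triangle y (x + t • e) (x + t • e')
  dsimp only at h1
  linarith

/-- The maximal function of a function constant on grid cubes controls the sum of its values over
the cubes met by a unit segment, for all directions close to that of the segment. -/
lemma le_kakeyaMax {n : ℕ} (hn : 0 < n) : ∃ c > (0:ℝ), ∀ δ ∈ Set.Ioo (0:ℝ) 1,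
    ∀ F : (Fin n → ℤ) → ℝ≥0∞, (∀ m, F m ≠ ∞) → ∀ e x : EuclideanSpace ℝ (Fin n),
    ∀ e' ∈ Metric.sphere (0 : EuclideanSpace ℝ (Fin n)) 1, dist e' e ≤ δ / 2 →
      ENNReal.ofReal (c * δ) * ∑' m, (cellIdx (δ / (2 * n)) '' seg e x).indicator F m ≤
        kakeyaMax δ (fun y => (F (cellIdx (δ / (2 * n)) y)).toReal) e' := by
  have hn' : (0:ℝ) < n := by exact_mod_cast hn
  obtain ⟨V, hV, hvol⟩ := volume_tube_le n
  refine ⟨1 / (V * (2 * n) ^ n), by positivity, fun δ hδ F hF e x e' he' hee => ?_⟩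
  have h0 := hδ.1
  have hσ : 0 < δ / (2 * n) := by positivity
  refine le_trans ?_ (le_iSup _ x)
  have hint : (∑' m, (cellIdx (δ / (2 * n)) '' seg e x).indicator F m) *
      ENNReal.ofReal ((δ / (2 * n)) ^ n) ≤
      ∫⁻ y in tube δ e' x, ENNReal.ofReal |(F (cellIdx (δ / (2 * n)) y)).toReal| := by
    rw [← lintegral_comp_cellIdx hσ, ← lintegral_indicator (by exact Metric.isClosed_cthickening.measurableSet)]
    refine lintegral_mono fun y => ?_
    by_cases hy : cellIdx (δ / (2 * n)) y ∈ cellIdx (δ / (2 * n)) '' seg e x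
    · obtain ⟨z, hz, hzy⟩ := id hy
      rw [Set.indicator_of_mem hy,
        Set.indicator_of_mem (mem_tube_of_cellIdx_eq hn h0 hee hz hzy.symm),
        abs_of_nonneg ENNReal.toReal_nonneg, ENNReal.ofReal_toReal (hF _)]
    · rw [Set.indicator_of_notMem hy]; exact zero_le
  refine le_trans ?_ (ENNReal.div_le_div hint (hvol δ hδ e' he' x))
  rw [ENNReal.div_eq_inv_mul, mul_comm (tsum _), ← mul_assoc, ← ENNReal.ofReal_inv_of_pos
    (div_pos (mul_pos hV (pow_pos h0 n)) h0), ← ENNReal.ofReal_mul (inv_nonneg.2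
    (div_pos (mul_pos hV (pow_pos h0 n)) h0).le)]
  refine mul_le_mul_left (le_of_eq (congrArg _ ?_)) _
  rw [div_pow]
  field_simp

/-- A strong-type bound for the maximal function of a function constant on grid cubes gives a
weak-type bound for an arbitrary, possibly non-measurable, set of directions. -/
lemma weak_type_of_strong_type {n : ℕ} {c δ r s : ℝ} (hr : 0 < r) (hδ : 0 < δ)
    (hn : 0 < n) (μ : Measure (EuclideanSpace ℝ (Fin n))) {A l : ℝ≥0∞}
    {F : (Fin n → ℤ) → ℝ≥0∞} (hF : ∀ m, F m ≠ ∞)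
    (hc : ∀ e x : EuclideanSpace ℝ (Fin n),
      ∀ e' ∈ Metric.sphere (0 : EuclideanSpace ℝ (Fin n)) 1, dist e' e ≤ δ / 2 →
        ENNReal.ofReal (c * δ) * ∑' m, (cellIdx (δ / (2 * n)) '' seg e x).indicator F m ≤
          kakeyaMax δ (fun y => (F (cellIdx (δ / (2 * n)) y)).toReal) e')
    (hA : (∫⁻ e in Metric.sphere (0 : EuclideanSpace ℝ (Fin n)) 1,
        (kakeyaMax δ (fun y => (F (cellIdx (δ / (2 * n)) y)).toReal) e) ^ r ∂μ) ^ r⁻¹ ≤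
      A * (∫⁻ y : EuclideanSpace ℝ (Fin n),
        ENNReal.ofReal |(F (cellIdx (δ / (2 * n)) y)).toReal| ^ s) ^ s⁻¹)
    {E : Set (EuclideanSpace ℝ (Fin n))}
    (hE : E ⊆ Metric.sphere (0 : EuclideanSpace ℝ (Fin n)) 1)
    (hl : ∀ e ∈ E, ∃ x, l ≤ ∑' m, (cellIdx (δ / (2 * n)) '' seg e x).indicator F m) :
    ENNReal.ofReal (c * δ) * l * μ E ^ r⁻¹ ≤
      A * ((∑' m, F m ^ s) * ENNReal.ofReal ((δ / (2 * n)) ^ n)) ^ s⁻¹ := by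
  have hn' : (0:ℝ) < n := by exact_mod_cast hn
  have hσ : 0 < δ / (2 * n) := by positivity
  have h1 : ∫⁻ y : EuclideanSpace ℝ (Fin n),
      ENNReal.ofReal |(F (cellIdx (δ / (2 * n)) y)).toReal| ^ s =
      (∑' m, F m ^ s) * ENNReal.ofReal ((δ / (2 * n)) ^ n) := by
    rw [← lintegral_comp_cellIdx hσ]
    refine lintegral_congr fun y => ?_
    rw [abs_of_nonneg ENNReal.toReal_nonneg, ENNReal.ofReal_toReal (hF _)]
  rw [← h1]
  refine le_trans ?_ hA
  rw [← ENNReal.rpow_le_rpow_iff hr, ENNReal.mul_rpow_of_nonneg _ _ hr.le, ENNReal.rpow_inv_rpow hr.ne',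
    ENNReal.rpow_inv_rpow hr.ne']
  set E' := Metric.thickening (δ / 2) E with hE'
  have hEE : E ⊆ E' ∩ Metric.sphere (0 : EuclideanSpace ℝ (Fin n)) 1 := fun e he =>
    ⟨Metric.self_subset_thickening (by positivity) _ he, hE he⟩
  calc (ENNReal.ofReal (c * δ) * l) ^ r * μ E
      ≤ (ENNReal.ofReal (c * δ) * l) ^ r *
        μ.restrict (Metric.sphere (0 : EuclideanSpace ℝ (Fin n)) 1) E' := by
        rw [Measure.restrict_apply Metric.isOpen_thickening.measurableSet]
        gcongr
    _ = ∫⁻ e in Metric.sphere (0 : EuclideanSpace ℝ (Fin n)) 1,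
          E'.indicator (fun _ => (ENNReal.ofReal (c * δ) * l) ^ r) e ∂μ := by
        rw [lintegral_indicator_const Metric.isOpen_thickening.measurableSet]
    _ ≤ _ := by
        refine setLIntegral_mono' Metric.isClosed_sphere.measurableSet fun e' he' => ?_
        by_cases h : e' ∈ E'
        · rw [Set.indicator_of_mem h]
          obtain ⟨e, he, hd⟩ := Metric.mem_thickening_iff.1 h
          obtain ⟨x, hx⟩ := hl e he
          refine ENNReal.rpow_le_rpow (le_trans ?_ (hc e x e' he' hd.le)) hr.le
          gcongr
        · rw [Set.indicator_of_notMem h]; exact zero_le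

/-- A set of positive Hausdorff measure has positive Hausdorff content. -/
lemma exists_pos_le_tsum_ediam_of_hausdorffMeasure_ne_zero {X ι : Type*} [MetricSpace X]
    [MeasurableSpace X] [BorelSpace X] [Countable ι] {u : ℝ} (hu : 0 < u) {A : Set X}
    (hA : μH[u] A ≠ 0) :
    ∃ N : ℕ, ∀ t : ι → Set X, A ⊆ ⋃ i, t i →
      ENNReal.ofReal (1 / ((N : ℝ) + 1)) ≤ ∑' i, Metric.ediam (t i) ^ u := by
  by_contra! hcon
  choose t ht hlt using hcon
  have hlim : Filter.Tendsto (fun N : ℕ => ENNReal.ofReal (1 / ((N : ℝ) + 1))) Filter.atTop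
      (nhds 0) := by
    simpa using ENNReal.tendsto_ofReal (tendsto_one_div_add_atTop_nhds_zero_nat (𝕜 := ℝ))
  have hlim' : Filter.Tendsto (fun N : ℕ => ENNReal.ofReal (1 / ((N : ℝ) + 1)) ^ u⁻¹) Filter.atTop
      (nhds 0) := by
    have := hlim.ennrpow_const u⁻¹
    rwa [ENNReal.zero_rpow_of_pos (inv_pos.2 hu)] at this
  refine hA (le_antisymm ?_ zero_le)
  refine (Measure.hausdorffMeasure_le_liminf_tsum u A _ hlim' t
    (Filter.Eventually.of_forall fun N i => ?_) (Filter.Eventually.of_forall ht)).trans ?_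
  · rw [← ENNReal.rpow_le_rpow_iff hu, ENNReal.rpow_inv_rpow hu.ne']
    exact (ENNReal.le_tsum i).trans (hlt N).le
  · refine (Filter.liminf_le_liminf (Filter.Eventually.of_forall fun N => (hlt N).le)).trans ?_
    rw [hlim.liminf_eq]

/-- A set of zero Hausdorff measure has zero Hausdorff content. -/
lemma exists_cover_of_hausdorffMeasure_eq_zero {X : Type*} [MetricSpace X]
    [MeasurableSpace X] [BorelSpace X] {d : ℝ} (hd : 0 < d) {A : Set X}
    (hA : μH[d] A = 0) {ε : ℝ≥0∞} (hε : ε ≠ 0) :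
    ∃ t : ℕ → Set X, A ⊆ ⋃ i, t i ∧ (∀ i, Metric.ediam (t i) ≤ 1) ∧
      ∑' i, Metric.ediam (t i) ^ d < ε := by
  rw [Measure.hausdorffMeasure_apply] at hA
  have h1 := (ENNReal.iSup_eq_zero.1 (ENNReal.iSup_eq_zero.1 hA 1)) one_pos
  have h2 := h1.trans_lt (pos_iff_ne_zero.2 hε)
  simp only [iInf_lt_iff] at h2
  obtain ⟨t, ht, htd, hlt⟩ := h2
  refine ⟨t, ht, htd, lt_of_le_of_lt (ENNReal.tsum_le_tsum fun i => ?_) hlt⟩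
  rcases (t i).eq_empty_or_nonempty with h | h
  · simp [h, ENNReal.zero_rpow_of_pos hd]
  · simp [h]

/-- A set that is a union of unit segments. -/
def IsUnionOfSegs {n : ℕ} (K : Set (EuclideanSpace ℝ (Fin n))) : Prop :=
  ∀ x ∈ K, ∃ e x₀, ‖e‖ = 1 ∧ x ∈ seg e x₀ ∧ seg e x₀ ⊆ K

lemma IsUnionOfSegs.exists_dist_eq {n : ℕ} {K : Set (EuclideanSpace ℝ (Fin n))}
    (hK : IsUnionOfSegs K) {x : EuclideanSpace ℝ (Fin n)} (hx : x ∈ K) {ρ : ℝ} (h0 : 0 ≤ ρ)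
    (h1 : ρ ≤ 1 / 2) : ∃ w ∈ K, dist x w = ρ := by
  obtain ⟨e, x₀, he, ⟨t, ⟨ht0, ht1⟩, rfl⟩, hsub⟩ := hK x hx
  rcases le_total t (1 / 2) with h | h
  · refine ⟨x₀ + (t + ρ) • e, hsub ⟨t + ρ, ⟨by linarith, by linarith⟩, rfl⟩, ?_⟩
    simp [dist_eq_norm, ← sub_smul, norm_smul, he, abs_of_nonneg h0]
  · refine ⟨x₀ + (t - ρ) • e, hsub ⟨t - ρ, ⟨by linarith, by linarith⟩, rfl⟩, ?_⟩
    simp [dist_eq_norm, ← sub_smul, norm_smul, he, abs_of_nonneg h0]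

lemma IsQSOn.dist_le {X Y : Type*} [MetricSpace X] [MetricSpace Y] {η : ℝ → ℝ} {g : X → Y}
    {K : Set X} (h : IsQSOn η g K) (hη : IsQSGauge η) {x y z : X} (hx : x ∈ K) (hy : y ∈ K)
    (hz : z ∈ K) (hxz : 0 < dist x z) {a : ℝ} (ha : dist x y ≤ a * dist x z) :
    dist (g x) (g y) ≤ η a * dist (g x) (g z) := by
  refine (h x hx y hy z hz (dist_pos.1 hxz)).trans ?_
  have h1 : dist x y / dist x z ≤ a := (div_le_iff₀ hxz).2 ha
  have h2 : 0 ≤ dist x y / dist x z := by positivity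
  exact mul_le_mul_of_nonneg_right
    (hη.2.1.monotoneOn (Set.mem_Ici.2 h2) (Set.mem_Ici.2 (h2.trans h1)) h1) dist_nonneg

lemma IsQSGauge.nonneg {η : ℝ → ℝ} (hη : IsQSGauge η) {a : ℝ} (ha : 0 ≤ a) : 0 ≤ η a :=
  hη.2.2.2.1 ha

lemma IsQSGauge.exists_pow_le {η : ℝ → ℝ} (hη : IsQSGauge η) :
    ∃ p : ℕ, 0 < p ∧ η ((1 / 2) ^ p) ≤ 1 / 2 := by
  have h1 : Filter.Tendsto (fun p : ℕ => (1 / 2 : ℝ) ^ p) Filter.atTop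
      (nhdsWithin 0 (Set.Ici 0)) :=
    tendsto_nhdsWithin_iff.2 ⟨tendsto_pow_atTop_nhds_zero_of_lt_one (by norm_num) (by norm_num),
      Filter.Eventually.of_forall fun p => Set.mem_Ici.2 (by positivity)⟩
  have h2 := (hη.2.2.1 0 Set.self_mem_Ici).tendsto.comp h1
  rw [hη.1] at h2
  obtain ⟨p, hp, hp0⟩ := ((h2.eventually_le_const (by norm_num : (0:ℝ) < 1 / 2)).and
    (Filter.eventually_gt_atTop 0)).exists
  exact ⟨p, hp0, hp⟩

lemma exists_dist_image_le {n : ℕ} {K : Set (EuclideanSpace ℝ (Fin n))} {X : Type*} [MetricSpace X]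
    {g : EuclideanSpace ℝ (Fin n) → X} {η : ℝ → ℝ} (hη : IsQSGauge η) (hqs : IsQSOn η g K)
    (hK : IsUnionOfSegs K) {R : ℝ} (hR : K ⊆ Metric.closedBall 0 R) :
    ∃ M > (0:ℝ), ∀ x ∈ K, ∀ y ∈ K, dist (g x) (g y) ≤ M := by
  rcases K.eq_empty_or_nonempty with rfl | ⟨x₀, hx₀⟩
  · exact ⟨1, one_pos, by simp⟩
  obtain ⟨z, hz, hxz⟩ := hK.exists_dist_eq hx₀ (by norm_num : (0:ℝ) ≤ 1 / 2) le_rfl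
  have hR0 : 0 ≤ R := dist_nonneg.trans (Metric.mem_closedBall.1 (hR hx₀))
  have h1 : ∀ y ∈ K, dist (g x₀) (g y) ≤ η (4 * R) * dist (g x₀) (g z) := fun y hy => by
    refine hqs.dist_le hη hx₀ hy hz (by rw [hxz]; norm_num) ?_
    have a1 := Metric.mem_closedBall.1 (hR hx₀)
    have a2 := Metric.mem_closedBall.1 (hR hy)
    have := dist_triangle_right x₀ y 0
    rw [hxz]; linarith
  have := hη.nonneg (by positivity : 0 ≤ 4 * R)
  refine ⟨2 * (η (4 * R) * dist (g x₀) (g z)) + 1, by positivity, fun x hx y hy => ?_⟩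
  have := dist_triangle_left (g x) (g y) (g x₀)
  linarith [h1 x hx, h1 y hy]

/-- Quasisymmetric maps on bounded unions of segments are Hölder continuous. -/
lemma exists_dist_image_le_pow {n : ℕ} {K : Set (EuclideanSpace ℝ (Fin n))} {X : Type*}
    [MetricSpace X] {g : EuclideanSpace ℝ (Fin n) → X} {η : ℝ → ℝ} (hη : IsQSGauge η)
    (hqs : IsQSOn η g K) (hK : IsUnionOfSegs K) {R : ℝ} (hR : K ⊆ Metric.closedBall 0 R) :
    ∃ C > (0:ℝ), ∃ θ ∈ Set.Ioo (0:ℝ) 1, ∀ k : ℕ, ∀ x ∈ K, ∀ y ∈ K, dist x y ≤ (1 / 2) ^ k →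
      dist (g x) (g y) ≤ C * θ ^ k := by
  obtain ⟨M, hM, hdist⟩ := exists_dist_image_le hη hqs hK hR
  obtain ⟨p, hp, hηp⟩ := hη.exists_pow_le
  have hη2 := hη.nonneg (by norm_num : (0:ℝ) ≤ 2)
  set θ : ℝ := (1 / 2) ^ ((p:ℝ)⁻¹) with hθ
  have hθ0 : 0 < θ := by positivity
  have hθ1 : θ < 1 := Real.rpow_lt_one (by norm_num) (by norm_num) (by positivity)
  have hθp : θ ^ p = 1 / 2 := Real.rpow_inv_natCast_pow (by norm_num) hp.ne'
  have hstep : ∀ x ∈ K, ∀ j : ℕ, ∀ w ∈ K, dist x w = (1 / 2) ^ (p * j + 1) →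
      dist (g x) (g w) ≤ (1 / 2) ^ j * M := by
    intro x hx j
    induction j with
    | zero => intro w hw _; simpa using hdist x hx w hw
    | succ j ih =>
      intro w hw hxw
      obtain ⟨w', hw', hxw'⟩ := hK.exists_dist_eq hx (ρ := (1 / 2) ^ (p * j + 1)) (by positivity)
        (by rw [pow_succ]
            exact mul_le_of_le_one_left (by norm_num) (pow_le_one₀ (by norm_num) (by norm_num)))
      have h1 := hqs.dist_le hη hx hw hw' (a := (1 / 2) ^ p) (by rw [hxw']; positivity)
        (by rw [hxw, hxw', ← pow_add]; apply le_of_eq; congr 1; ring)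
      calc dist (g x) (g w) ≤ _ := h1
        _ ≤ 1 / 2 * ((1 / 2) ^ j * M) := mul_le_mul hηp (ih w' hw' hxw') dist_nonneg (by norm_num)
        _ = _ := by ring
  refine ⟨(η 2 + 1) * M * 2, by positivity, θ, ⟨hθ0, hθ1⟩, fun k x hx y hy hxy => ?_⟩
  obtain ⟨w, hw, hxw⟩ := hK.exists_dist_eq hx (ρ := (1 / 2) ^ (p * (k / p) + 1)) (by positivity)
    (by rw [pow_succ]
        exact mul_le_of_le_one_left (by norm_num) (pow_le_one₀ (by norm_num) (by norm_num)))
  have h1 := hqs.dist_le hη hx hy hw (a := 2) (by rw [hxw]; positivity) (by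
    rw [hxw, pow_succ]
    refine hxy.trans ?_
    have := pow_le_pow_of_le_one (by norm_num : (0:ℝ) ≤ 1 / 2) (by norm_num) (Nat.mul_div_le k p)
    linarith)
  have h2 : (1 / 2 : ℝ) ^ (k / p) ≤ 2 * θ ^ k := by
    have h3 : k ≤ p * (k / p) + p := by
      have := Nat.div_add_mod k p
      have := Nat.mod_lt k hp
      omega
    have h4 := pow_le_pow_of_le_one hθ0.le hθ1.le h3
    rw [pow_add, pow_mul, hθp] at h4
    linarith
  calc dist (g x) (g y) ≤ _ := h1
    _ ≤ η 2 * ((1 / 2) ^ (k / p) * M) := by gcongr; exact hstep x hx _ w hw hxw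
    _ ≤ (η 2 + 1) * ((2 * θ ^ k) * M) := by gcongr; linarith
    _ = _ := by ring

/-- The image under `g` of the part of `K` in a grid cube at scale `2 ^ (-(k + 1))`. -/
def cellImage {n : ℕ} {X : Type*} (g : EuclideanSpace ℝ (Fin n) → X)
    (K : Set (EuclideanSpace ℝ (Fin n))) (p : ℕ × (Fin n → ℤ)) : Set X :=
  g '' (K ∩ cellIdx ((1 / 2) ^ (p.1 + 1) / (2 * n)) ⁻¹' {p.2})

lemma ediam_cellImage_le {n : ℕ} (hn : 0 < n) {K : Set (EuclideanSpace ℝ (Fin n))} {X : Type*}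
    [MetricSpace X] {g : EuclideanSpace ℝ (Fin n) → X} {C θ : ℝ}
    (h : ∀ k : ℕ, ∀ x ∈ K, ∀ y ∈ K, dist x y ≤ (1 / 2) ^ k → dist (g x) (g y) ≤ C * θ ^ k)
    (p : ℕ × (Fin n → ℤ)) : Metric.ediam (cellImage g K p) ≤ ENNReal.ofReal (C * θ ^ p.1) := by
  have hn' : (0:ℝ) < n := by exact_mod_cast hn
  refine Metric.ediam_le ?_
  rintro _ ⟨x, ⟨hx, hxp⟩, rfl⟩ _ ⟨y, ⟨hy, hyp⟩, rfl⟩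
  rw [edist_dist]
  refine ENNReal.ofReal_le_ofReal (h p.1 x hx y hy ?_)
  refine (dist_le_of_cellIdx_eq (by positivity) (hxp.trans (Eq.symm hyp))).trans ?_
  have : (n:ℝ) * ((1 / 2) ^ (p.1 + 1) / (2 * n)) = (1 / 2) ^ p.1 / 4 := by
    rw [pow_succ]; field_simp; norm_num
  rw [this]
  exact div_le_self (by positivity) (by norm_num)

/-- The preimage in `K` of a set `U` is covered by grid cubes whose images have small diameter
compared with `U`. -/
lemma exists_cells_cover_preimage {n : ℕ} (hn : 0 < n) {K : Set (EuclideanSpace ℝ (Fin n))}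
    {X : Type*} [MetricSpace X] {g : EuclideanSpace ℝ (Fin n) → X} {η : ℝ → ℝ} (hη : IsQSGauge η)
    (hqs : IsQSOn η g K) {R : ℝ} (hR0 : 0 < R) (hR : K ⊆ Metric.closedBall 0 R) {C θ : ℝ}
    (hθ : θ ∈ Set.Ioo (0:ℝ) 1)
    (h : ∀ k : ℕ, ∀ x ∈ K, ∀ y ∈ K, dist x y ≤ (1 / 2) ^ k → dist (g x) (g y) ≤ C * θ ^ k)
    {t : ℝ} (ht : 0 < t) :
    ∃ B > (0:ℝ), ∀ U : Set X, ∀ τ : ℝ≥0∞, τ ≠ 0 → ∃ Q : Set (ℕ × (Fin n → ℤ)),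
      (∀ y ∈ K, g y ∈ U → ∃ k, (k, cellIdx ((1 / 2) ^ (k + 1) / (2 * n)) y) ∈ Q) ∧
      ∑' p : Q, Metric.ediam (cellImage g K p) ^ t ≤
        ENNReal.ofReal B * Metric.ediam U ^ t + τ := by
  have hn' : (0:ℝ) < n := by exact_mod_cast hn
  set T : ℕ := ⌈8 * R * n + 1⌉₊ with hT
  have hTle : 8 * R * n + 1 ≤ T := Nat.le_ceil _
  set H : ℝ := η ((T + 1) / (2 * R)) with hH
  have hH0 : 0 ≤ H := hη.nonneg (by positivity)
  refine ⟨(2 * T + 1) ^ n * (2 * (H + 1)) ^ t, by positivity, fun U τ hτ => ?_⟩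
  set V := K ∩ g ⁻¹' U with hV
  rcases V.subsingleton_or_nontrivial with hs | hs
  · rcases V.eq_empty_or_nonempty with he | ⟨a, ha⟩
    · refine ⟨∅, fun y hy hyU => ?_, by simp⟩
      have : y ∈ V := ⟨hy, hyU⟩
      simp [he] at this
    · have hlim : Filter.Tendsto (fun k : ℕ => ENNReal.ofReal (C * θ ^ k) ^ t) Filter.atTop
          (nhds 0) := by
        have h1 := (tendsto_pow_atTop_nhds_zero_of_lt_one hθ.1.le hθ.2).const_mul C
        have h2 := (ENNReal.tendsto_ofReal h1).ennrpow_const t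
        simpa [ENNReal.zero_rpow_of_pos ht] using h2
      obtain ⟨k, hk⟩ := (hlim.eventually_le_const (pos_iff_ne_zero.2 hτ)).exists
      refine ⟨{(k, cellIdx ((1 / 2) ^ (k + 1) / (2 * n)) a)}, fun y hy hyU => ?_, ?_⟩
      · rw [hs ⟨hy, hyU⟩ ha]; exact ⟨k, rfl⟩
      · rw [tsum_singleton _ (fun p => Metric.ediam (cellImage g K p) ^ t)]
        refine le_trans ?_ (hk.trans le_add_self)
        exact ENNReal.rpow_le_rpow (ediam_cellImage_le hn h _) ht.le
  · have hVR : V ⊆ Metric.closedBall 0 R := Set.inter_subset_left.trans hR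
    have hVb : Bornology.IsBounded V := Metric.isBounded_closedBall.subset hVR
    set d := Metric.diam V with hd
    have hd0 : 0 < d := Metric.diam_pos hs hVb
    have hd2 : d ≤ 2 * R := (Metric.diam_mono hVR Metric.isBounded_closedBall).trans
      (Metric.diam_closedBall hR0.le)
    obtain ⟨a, ha, b, hb, hab⟩ : ∃ a ∈ V, ∃ b ∈ V, d / 2 < dist a b := by
      by_contra! hcon
      have := Metric.diam_le_of_forall_dist_le (by positivity) hcon
      linarith
    obtain ⟨k, hk1, hk2⟩ := exists_nat_pow_near_of_lt_one (x := d / (2 * R)) (y := (1 / 2 : ℝ))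
      (by positivity) ((div_le_one (by positivity)).2 hd2) (by norm_num) (by norm_num)
    set δ : ℝ := (1 / 2) ^ (k + 1) with hδ
    have hδ0 : 0 < δ := by positivity
    have hδ2 : (1 / 2 : ℝ) ^ k = 2 * δ := by rw [hδ, pow_succ]; ring
    rw [hδ2, div_le_iff₀ (by positivity)] at hk2
    rw [lt_div_iff₀ (by positivity)] at hk1
    have hσ : 0 < δ / (2 * n) := by positivity
    set m := cellIdx (δ / (2 * n)) a with hm
    set s : Finset (ℕ × (Fin n → ℤ)) :=
      {k} ×ˢ Finset.Icc (fun i => m i - (T : ℤ)) (fun i => m i + (T : ℤ)) with hsdef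
    have hcard : s.card = (2 * T + 1) ^ n := by
      simp only [hsdef, Finset.card_product, Finset.card_singleton, Pi.card_Icc, Int.card_Icc, one_mul]
      rw [Finset.prod_congr rfl (g := fun _ => 2 * T + 1) fun i _ => by omega]
      simp
    have habs : ∀ y, cellIdx (δ / (2 * n)) y ∈
        Finset.Icc (fun i => m i - (T : ℤ)) (fun i => m i + (T : ℤ)) ↔
        ∀ i, |((cellIdx (δ / (2 * n)) a i : ℤ) : ℝ) - cellIdx (δ / (2 * n)) y i| ≤ T := by
      intro y
      simp only [Finset.mem_Icc, Pi.le_def, ← forall_and]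
      refine forall_congr' fun i => ?_
      rw [abs_le, ← hm]
      have e1 : (T:ℝ) = ((T:ℤ):ℝ) := by push_cast; rfl
      rw [e1]
      constructor
      · rintro ⟨h1, h2⟩
        have h1' : ((m i - (T:ℤ) : ℤ) : ℝ) ≤ _ := Int.cast_le.2 h1
        have h2' : _ ≤ ((m i + (T:ℤ) : ℤ) : ℝ) := Int.cast_le.2 h2
        push_cast at h1' h2' ⊢
        exact ⟨by linarith, by linarith⟩
      · rintro ⟨h1, h2⟩
        have h1' : ((-(T:ℤ) : ℤ) : ℝ) ≤ ((m i - cellIdx (δ / (2 * n)) y i : ℤ) : ℝ) := by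
          push_cast at h1 ⊢; exact h1
        have h2' : ((m i - cellIdx (δ / (2 * n)) y i : ℤ) : ℝ) ≤ ((T:ℤ) : ℝ) := by
          push_cast at h2 ⊢; exact h2
        rw [Int.cast_le] at h1' h2'
        exact ⟨by linarith, by linarith⟩
    refine ⟨(s : Set (ℕ × (Fin n → ℤ))), fun y hy hyU => ⟨k, ?_⟩, ?_⟩
    · simp only [hsdef, Finset.coe_product, Set.mem_prod, Finset.coe_singleton,
        Set.mem_singleton_iff, true_and, Finset.mem_coe]
      refine (habs y).2 fun i => (abs_cellIdx_sub_le hσ a y i).trans (le_trans ?_ hTle)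
      have h1 : dist a y ≤ d := Metric.dist_le_diam_of_mem hVb ha ⟨hy, hyU⟩
      have h2 : dist a y / (δ / (2 * n)) ≤ 8 * R * n := by
        rw [div_le_iff₀ hσ]
        have : 8 * R * n * (δ / (2 * n)) = 2 * δ * (2 * R) := by field_simp; norm_num
        linarith
      linarith
    · rw [Finset.tsum_subtype' s (fun p => Metric.ediam (cellImage g K p) ^ t)]
      refine le_trans ?_ le_self_add
      have hmain : ∀ p ∈ s, Metric.ediam (cellImage g K p) ^ t ≤
          (ENNReal.ofReal (2 * (H + 1)) * Metric.ediam U) ^ t := by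
        rintro ⟨k', m'⟩ hp
        simp only [hsdef, Finset.mem_product, Finset.mem_singleton] at hp
        obtain ⟨rfl, hm'⟩ := hp
        refine ENNReal.rpow_le_rpow (Metric.ediam_le ?_) ht.le
        have hone : ∀ x ∈ K, cellIdx (δ / (2 * n)) x = m' →
            edist (g a) (g x) ≤ ENNReal.ofReal (H + 1) * Metric.ediam U := by
          intro x hx hxm
          have h1 := dist_le_of_abs_cellIdx_sub_le hσ ((habs x).1 (hxm ▸ hm'))
          have h2 := hqs.dist_le hη ha.1 hx hb.1 (a := (T + 1) / (2 * R)) (by linarith) (by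
            refine h1.trans ?_
            have e1 : (n:ℝ) * ((T + 1) * (δ / (2 * n))) = (T + 1) / (2 * R) * (R * δ) := by
              field_simp
            rw [e1]
            gcongr
            linarith)
          rw [edist_dist]
          calc ENNReal.ofReal (dist (g a) (g x))
              ≤ ENNReal.ofReal ((H + 1) * dist (g a) (g b)) :=
                ENNReal.ofReal_le_ofReal (h2.trans (by gcongr; linarith))
            _ = ENNReal.ofReal (H + 1) * edist (g a) (g b) := by
                rw [ENNReal.ofReal_mul (by positivity), edist_dist]
            _ ≤ _ := by gcongr; exact Metric.edist_le_ediam_of_mem ha.2 hb.2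
        rintro _ ⟨x, ⟨hx, hxp⟩, rfl⟩ _ ⟨y, ⟨hy, hyp⟩, rfl⟩
        refine (edist_triangle_left _ _ (g a)).trans ?_
        rw [ENNReal.ofReal_mul (by norm_num), ENNReal.ofReal_ofNat, two_mul, add_mul]
        exact add_le_add (hone x hx hxp) (hone y hy hyp)
      refine (Finset.sum_le_card_nsmul _ _ _ hmain).trans (le_of_eq ?_)
      rw [hcard, nsmul_eq_mul, ENNReal.mul_rpow_of_nonneg _ _ ht.le, ← mul_assoc,
        ENNReal.ofReal_rpow_of_nonneg (by positivity) ht.le, ENNReal.ofReal_mul (by positivity)]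
      congr 2
      rw [← ENNReal.ofReal_natCast]
      push_cast
      rfl

/-- If the target has vanishing `t`-dimensional measure, `K` is covered by grid cubes whose images
have arbitrarily small total `t`-dimensional size. -/
lemma exists_cells_cover {n : ℕ} {K : Set (EuclideanSpace ℝ (Fin n))}
    {X : Type*} [MetricSpace X] [MeasurableSpace X] [BorelSpace X]
    {g : EuclideanSpace ℝ (Fin n) → X} {t B : ℝ} (ht : 0 < t) (hB : 0 < B)
    (hcov : ∀ U : Set X, ∀ τ : ℝ≥0∞, τ ≠ 0 → ∃ Q : Set (ℕ × (Fin n → ℤ)),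
      (∀ y ∈ K, g y ∈ U → ∃ k, (k, cellIdx ((1 / 2) ^ (k + 1) / (2 * n)) y) ∈ Q) ∧
      ∑' p : Q, Metric.ediam (cellImage g K p) ^ t ≤
        ENNReal.ofReal B * Metric.ediam U ^ t + τ)
    (hHt : μH[t] (Set.univ : Set X) = 0) {ω : ℝ} (hω : 0 < ω) :
    ∃ Q : Set (ℕ × (Fin n → ℤ)),
      (∀ y ∈ K, ∃ k, (k, cellIdx ((1 / 2) ^ (k + 1) / (2 * n)) y) ∈ Q) ∧
      ∑' p : Q, Metric.ediam (cellImage g K p) ^ t ≤ ENNReal.ofReal ω := by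
  obtain ⟨U, hU, -, hUsum⟩ := exists_cover_of_hausdorffMeasure_eq_zero ht hHt
    (ε := ENNReal.ofReal (ω / (2 * B))) (ENNReal.ofReal_pos.2 (by positivity)).ne'
  obtain ⟨τ, hτ0, hτ⟩ := ENNReal.exists_pos_sum_of_countable
    (ENNReal.ofReal_pos.2 (by positivity : 0 < ω / 2)).ne' ℕ
  choose Q hQ hQsum using fun i => hcov (U i) (τ i) (by exact_mod_cast (hτ0 i).ne')
  refine ⟨⋃ i, Q i, fun y hy => ?_, ?_⟩
  · obtain ⟨i, hi⟩ := Set.mem_iUnion.1 (hU (Set.mem_univ (g y)))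
    obtain ⟨k, hk⟩ := hQ i y hy hi
    exact ⟨k, Set.mem_iUnion.2 ⟨i, hk⟩⟩
  · calc ∑' p : ⋃ i, Q i, Metric.ediam (cellImage g K p) ^ t
        ≤ ∑' i, ∑' p : Q i, Metric.ediam (cellImage g K p) ^ t :=
          ENNReal.tsum_iUnion_le_tsum (fun p => Metric.ediam (cellImage g K p) ^ t) Q
      _ ≤ ∑' i, (ENNReal.ofReal B * Metric.ediam (U i) ^ t + τ i) := ENNReal.tsum_le_tsum hQsum
      _ = ENNReal.ofReal B * ∑' i, Metric.ediam (U i) ^ t + ∑' i, (τ i : ℝ≥0∞) := by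
          rw [ENNReal.tsum_add, ENNReal.tsum_mul_left]
      _ ≤ ENNReal.ofReal B * ENNReal.ofReal (ω / (2 * B)) + ENNReal.ofReal (ω / 2) := by
          gcongr
      _ = ENNReal.ofReal ω := by
          rw [← ENNReal.ofReal_mul hB.le, ← ENNReal.ofReal_add (by positivity) (by positivity)]
          congr 1
          field_simp
          norm_num

/-- The `u`-th power of the diameter of the image of a cube at scale `k` in the family `Q`. -/
def cellWeight {n : ℕ} {X : Type*} [MetricSpace X] (g : EuclideanSpace ℝ (Fin n) → X)
    (K : Set (EuclideanSpace ℝ (Fin n))) (Q : Set (ℕ × (Fin n → ℤ))) (u : ℝ) (k : ℕ)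
    (m : Fin n → ℤ) : ℝ≥0∞ :=
  Q.indicator (fun p => Metric.ediam (cellImage g K p) ^ u) (k, m)

lemma tsum_cellWeight_rpow_le {n : ℕ} {X : Type*} [MetricSpace X]
    {g : EuclideanSpace ℝ (Fin n) → X} {K : Set (EuclideanSpace ℝ (Fin n))}
    {Q : Set (ℕ × (Fin n → ℤ))} {u s t W : ℝ} {D : ℕ → ℝ} (hs : 0 < s) (ht : 0 ≤ t)
    (htu : t ≤ u * s) (hD0 : ∀ k, 0 ≤ D k)
    (hD : ∀ p, Metric.ediam (cellImage g K p) ≤ ENNReal.ofReal (D p.1))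
    (hQ : ∑' p : Q, Metric.ediam (cellImage g K p) ^ t ≤ ENNReal.ofReal W) (k : ℕ) :
    ∑' m, cellWeight g K Q u k m ^ s ≤ ENNReal.ofReal (D k ^ (u * s - t) * W) := by
  have h1 : ∀ m, cellWeight g K Q u k m ^ s ≤ ENNReal.ofReal (D k ^ (u * s - t)) *
      Q.indicator (fun p => Metric.ediam (cellImage g K p) ^ t) (k, m) := by
    intro m
    unfold cellWeight
    by_cases h : (k, m) ∈ Q
    · rw [Set.indicator_of_mem h, Set.indicator_of_mem h, ← ENNReal.rpow_mul,
        show u * s = (u * s - t) + t by ring, ENNReal.rpow_add_of_nonneg _ _ (by linarith) ht,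
        ← ENNReal.ofReal_rpow_of_nonneg (hD0 k) (by linarith), add_sub_cancel_right]
      gcongr
      exact hD (k, m)
    · rw [Set.indicator_of_notMem h, ENNReal.zero_rpow_of_pos hs]; exact zero_le
  calc ∑' m, cellWeight g K Q u k m ^ s
      ≤ ENNReal.ofReal (D k ^ (u * s - t)) *
        ∑' m, Q.indicator (fun p => Metric.ediam (cellImage g K p) ^ t) (k, m) := by
        rw [← ENNReal.tsum_mul_left]; exact ENNReal.tsum_le_tsum h1
    _ ≤ ENNReal.ofReal (D k ^ (u * s - t)) * ENNReal.ofReal W := by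
        gcongr
        refine (ENNReal.tsum_comp_le_tsum_of_injective (f := fun m : Fin n → ℤ => (k, m))
          (Prod.mk_right_injective k) _).trans ?_
        rw [← tsum_subtype Q fun p => Metric.ediam (cellImage g K p) ^ t]
        exact hQ
    _ = _ := (ENNReal.ofReal_mul (Real.rpow_nonneg (hD0 k) _)).symm

lemma exists_le_tsum_cellWeight {n : ℕ} {X : Type*} [MetricSpace X]
    {g : EuclideanSpace ℝ (Fin n) → X} {K : Set (EuclideanSpace ℝ (Fin n))}
    {Q : Set (ℕ × (Fin n → ℤ))}
    (hQ : ∀ y ∈ K, ∃ k, (k, cellIdx ((1 / 2) ^ (k + 1) / (2 * n)) y) ∈ Q)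
    {u : ℝ} (hu : 0 < u) {e x : EuclideanSpace ℝ (Fin n)} (hx : seg e x ⊆ K) {c : ℝ≥0∞}
    (hc : ∀ T : ℕ × (Fin n → ℤ) → Set X, g '' seg e x ⊆ ⋃ i, T i →
      c ≤ ∑' i, Metric.ediam (T i) ^ u)
    {a : ℕ → ℝ≥0∞} (ha : ∑' k, a k < c) :
    ∃ k, a k ≤ ∑' m, (cellIdx ((1 / 2) ^ (k + 1) / (2 * n)) '' seg e x).indicator
      (cellWeight g K Q u k) m := by
  classical
  by_contra! hcon
  refine (hc (fun p => if p ∈ Q ∧ p.2 ∈ cellIdx ((1 / 2) ^ (p.1 + 1) / (2 * n)) '' seg e x then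
    cellImage g K p else ∅) ?_).not_gt (lt_of_le_of_lt ?_ ha)
  · rintro _ ⟨y, hy, rfl⟩
    obtain ⟨k, hk⟩ := hQ y (hx hy)
    refine Set.mem_iUnion.2 ⟨(k, cellIdx ((1 / 2) ^ (k + 1) / (2 * n)) y), ?_⟩
    rw [if_pos ⟨hk, y, hy, rfl⟩]
    exact ⟨y, ⟨hx hy, rfl⟩, rfl⟩
  · rw [ENNReal.tsum_prod']
    refine ENNReal.tsum_le_tsum fun k => le_trans (le_of_eq (tsum_congr fun m => ?_)) (hcon k).le
    unfold cellWeight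
    by_cases h1 : m ∈ cellIdx ((1 / 2) ^ (k + 1) / (2 * n)) '' seg e x
    · by_cases h2 : (k, m) ∈ Q
      · rw [if_pos ⟨h2, h1⟩, Set.indicator_of_mem h1, Set.indicator_of_mem h2]
      · rw [if_neg fun h => h2 h.1, Set.indicator_of_mem h1, Set.indicator_of_notMem h2,
          Metric.ediam_empty, ENNReal.zero_rpow_of_pos hu]
    · rw [if_neg fun h => h1 h.2, Set.indicator_of_notMem h1, Metric.ediam_empty,
        ENNReal.zero_rpow_of_pos hu]

/-- The bookkeeping of exponents at scale `2 ^ (-(k + 1))`. -/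
lemma scale_bound_eq {n : ℕ} (hn : 0 < n) {s v θ β ε C D ω : ℝ} (hs : 0 < s) (hθ : 0 < θ)
    (hβ : β = θ ^ (v / (3 * s))) (hε : (1 / 2 : ℝ) ^ ε = β) (hD : 0 < D) (hω : 0 < ω) (k : ℕ) :
    C * ((1 / 2 : ℝ) ^ (k + 1)) ^ (-(((n : ℝ) - s) / s) - ε) *
      ((D * θ ^ k) ^ v * ω ^ s * ((1 / 2 : ℝ) ^ (k + 1) / (2 * n)) ^ n) ^ s⁻¹ =
    (C * D ^ (v / s) * ((1 / (2 * n : ℝ)) ^ n) ^ s⁻¹ * β⁻¹) * ω * β ^ (2 * k) *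
      (1 / 2 : ℝ) ^ (k + 1) := by
  have hn' : (0:ℝ) < n := by exact_mod_cast hn
  have hβ0 : 0 < β := hβ ▸ Real.rpow_pos_of_pos hθ _
  set δ : ℝ := (1 / 2) ^ (k + 1) with hδ
  have hδ0 : 0 < δ := by positivity
  have h1 : δ ^ ε = β ^ (k + 1) := by
    rw [hδ, ← Real.rpow_natCast, ← Real.rpow_mul (by norm_num), mul_comm, Real.rpow_mul (by norm_num),
      hε, Real.rpow_natCast]
  have h2 : ((D * θ ^ k) ^ v) ^ s⁻¹ = D ^ (v / s) * β ^ (3 * k) := by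
    rw [← Real.rpow_mul (by positivity), ← div_eq_mul_inv, Real.mul_rpow hD.le (by positivity), hβ,
      ← Real.rpow_natCast, ← Real.rpow_natCast, ← Real.rpow_mul hθ.le, ← Real.rpow_mul hθ.le]
    congr 2
    push_cast
    field_simp
  have h3 : (ω ^ s) ^ s⁻¹ = ω := Real.rpow_rpow_inv hω.le hs.ne'
  have h4 : ((δ / (2 * n)) ^ n) ^ s⁻¹ = δ ^ ((n:ℝ) / s) * ((1 / (2 * n : ℝ)) ^ n) ^ s⁻¹ := by
    rw [div_eq_mul_one_div, mul_pow, Real.mul_rpow (by positivity) (by positivity),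
      ← Real.rpow_natCast δ n, ← Real.rpow_mul hδ0.le, ← div_eq_mul_inv]
  have h5 : δ ^ (-(((n : ℝ) - s) / s) - ε) * δ ^ ((n:ℝ) / s) = δ * (β ^ (k + 1))⁻¹ := by
    rw [← Real.rpow_add hδ0, ← h1, ← Real.rpow_neg hδ0.le]
    nth_rewrite 2 [← Real.rpow_one δ]
    rw [← Real.rpow_add hδ0]
    congr 1
    field_simp
    ring
  rw [Real.mul_rpow (by positivity) (by positivity), Real.mul_rpow (by positivity) (by positivity),
    h2, h3, h4]
  calc _ = C * D ^ (v / s) * ((1 / (2 * n : ℝ)) ^ n) ^ s⁻¹ * ω * β ^ (3 * k) *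
        (δ ^ (-(((n : ℝ) - s) / s) - ε) * δ ^ ((n:ℝ) / s)) := by ring
    _ = _ := by
      rw [h5, pow_succ, pow_mul' β 3 k, pow_mul' β 2 k]
      field_simp

lemma measure_le_of_scale_bound {a b r : ℝ} (ha : 0 < a) (hr : 0 < r) {μE : ℝ≥0∞}
    (h : ENNReal.ofReal a * μE ^ r⁻¹ ≤ ENNReal.ofReal b) :
    μE ≤ ENNReal.ofReal (b / a) ^ r := by
  rw [← ENNReal.rpow_inv_le_iff hr, ENNReal.ofReal_div_of_pos ha,
    ENNReal.le_div_iff_mul_le (Or.inl (ENNReal.ofReal_pos.2 ha).ne') (Or.inl ENNReal.ofReal_ne_top),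
    mul_comm]
  exact h

/-- Under a Kakeya maximal estimate, a quasisymmetry onto a space of vanishing `t`-dimensional
measure cannot send the segments in a non-null set of directions onto sets whose `u`-dimensional
content is bounded below, provided `t < u * s`. -/
lemma measure_directions_eq_zero {n : ℕ} (hn : 0 < n) {r s : ℝ} (hr : 0 < r) (hs : 0 < s)
    (μ : Measure (EuclideanSpace ℝ (Fin n)))
    (hyp : ∀ ε > (0:ℝ), ∃ C > (0:ℝ), ∀ δ ∈ Set.Ioo (0:ℝ) 1,
      ∀ f : EuclideanSpace ℝ (Fin n) → ℝ, Measurable f →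
        (∫⁻ e in Metric.sphere (0 : EuclideanSpace ℝ (Fin n)) 1, (kakeyaMax δ f e) ^ r ∂μ) ^ r⁻¹ ≤
          ENNReal.ofReal (C * δ ^ (-(((n : ℝ) - s) / s) - ε)) *
            (∫⁻ y, ENNReal.ofReal |f y| ^ s) ^ s⁻¹)
    {X : Type*} [MetricSpace X] [MeasurableSpace X] [BorelSpace X]
    {g : EuclideanSpace ℝ (Fin n) → X} {η : ℝ → ℝ} (hη : IsQSGauge η)
    {K : Set (EuclideanSpace ℝ (Fin n))} (hqs : IsQSOn η g K) (hK : IsUnionOfSegs K)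
    {R : ℝ} (hR0 : 0 < R) (hR : K ⊆ Metric.closedBall 0 R)
    {u t : ℝ} (ht : 0 < t) (hu : 0 < u) (htu : t < u * s)
    (hHt : μH[t] (Set.univ : Set X) = 0) {c : ℝ} (hc : 0 < c)
    {E : Set (EuclideanSpace ℝ (Fin n))}
    (hE : E ⊆ Metric.sphere (0 : EuclideanSpace ℝ (Fin n)) 1)
    (hcontent : ∀ e ∈ E, ∃ x, seg e x ⊆ K ∧ ∀ T : ℕ × (Fin n → ℤ) → Set X,
      g '' seg e x ⊆ ⋃ i, T i → ENNReal.ofReal c ≤ ∑' i, Metric.ediam (T i) ^ u) :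
    μ E = 0 := by
  have hn' : (0:ℝ) < n := by exact_mod_cast hn
  obtain ⟨D, hD, θ, hθ, hhol⟩ := exists_dist_image_le_pow hη hqs hK hR
  obtain ⟨B, hB, hcov⟩ := exists_cells_cover_preimage hn hη hqs hR0 hR hθ hhol ht
  obtain ⟨b, hb, hkak⟩ := le_kakeyaMax hn
  set v : ℝ := u * s - t with hv
  have hv0 : 0 < v := by linarith
  set β : ℝ := θ ^ (v / (3 * s)) with hβ
  have hβ0 : 0 < β := Real.rpow_pos_of_pos hθ.1 _
  have hβ1 : β < 1 := Real.rpow_lt_one hθ.1.le hθ.2 (by positivity)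
  set ε : ℝ := Real.logb (1 / 2) β with hεdef
  have hε : (1 / 2 : ℝ) ^ ε = β := Real.rpow_logb (by norm_num) (by norm_num) hβ0
  have hε0 : 0 < ε := Real.logb_pos_of_base_lt_one (by norm_num) (by norm_num) hβ0 hβ1
  obtain ⟨C, hC, hmax⟩ := hyp ε hε0
  have h1β : 0 < 1 - β := by linarith
  set A : ℝ := C * D ^ (v / s) * ((1 / (2 * n : ℝ)) ^ n) ^ s⁻¹ * β⁻¹ with hA
  have hA0 : 0 < A := by positivity
  set M : ℝ := A / (b * (c / 2 * (1 - β))) with hM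
  have hM0 : 0 < M := by positivity
  have hβr : β ^ r < 1 := Real.rpow_lt_one hβ0.le hβ1 hr
  have hβr0 : 0 < β ^ r := Real.rpow_pos_of_pos hβ0 _
  have key : ∀ ω > (0:ℝ), μ E ≤ ENNReal.ofReal ((M * ω) ^ r * (1 - β ^ r)⁻¹) := by
    intro ω hω
    obtain ⟨Q, hQ, hQsum⟩ := exists_cells_cover ht hB hcov hHt (ω := ω ^ s) (by positivity)
    set a : ℕ → ℝ := fun k => c / 2 * (1 - β) * β ^ k with ha
    have ha0 : ∀ k, 0 < a k := fun k => by positivity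
    have hasum : ∑' k, ENNReal.ofReal (a k) < ENNReal.ofReal c := by
      have h1 : HasSum a (c / 2) := by
        have := (hasSum_geometric_of_lt_one hβ0.le hβ1).mul_left (c / 2 * (1 - β))
        rwa [mul_assoc, mul_inv_cancel₀ h1β.ne', mul_one] at this
      rw [← ENNReal.ofReal_tsum_of_nonneg (fun k => (ha0 k).le) h1.summable, h1.tsum_eq]
      exact (ENNReal.ofReal_lt_ofReal_iff hc).2 (by linarith)
    set Ek : ℕ → Set (EuclideanSpace ℝ (Fin n)) := fun k => {e ∈ E | ∃ x, ENNReal.ofReal (a k) ≤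
      ∑' m, (cellIdx ((1 / 2) ^ (k + 1) / (2 * n)) '' seg e x).indicator
        (cellWeight g K Q u k) m} with hEk
    have hsub : E ⊆ ⋃ k, Ek k := fun e he => by
      obtain ⟨x, hx, hxc⟩ := hcontent e he
      obtain ⟨k, hk⟩ := exists_le_tsum_cellWeight hQ hu hx hxc hasum
      exact Set.mem_iUnion.2 ⟨k, he, x, hk⟩
    have hEkle : ∀ k, μ (Ek k) ≤ ENNReal.ofReal ((M * ω) ^ r * (β ^ r) ^ k) := by
      intro k
      set δ : ℝ := (1 / 2) ^ (k + 1) with hδ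
      have hδ0 : 0 < δ := by positivity
      have hδ1 : δ ∈ Set.Ioo (0:ℝ) 1 :=
        ⟨hδ0, pow_lt_one₀ (by norm_num) (by norm_num) k.succ_ne_zero⟩
      have hD0 : ∀ k : ℕ, 0 ≤ D * θ ^ k := fun k => mul_nonneg hD.le (pow_nonneg hθ.1.le k)
      have hFtop : ∀ m, cellWeight g K Q u k m ≠ ∞ := fun m => by
        unfold cellWeight
        by_cases h : (k, m) ∈ Q
        · rw [Set.indicator_of_mem h]
          exact (ENNReal.rpow_lt_top_of_nonneg hu.le
            ((ediam_cellImage_le hn hhol (k, m)).trans_lt ENNReal.ofReal_lt_top).ne).ne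
        · rw [Set.indicator_of_notMem h]; exact ENNReal.zero_ne_top
      have hmeas : Measurable fun y : EuclideanSpace ℝ (Fin n) =>
          (cellWeight g K Q u k (cellIdx (δ / (2 * n)) y)).toReal :=
        ((measurable_of_countable (cellWeight g K Q u k)).comp (measurable_cellIdx _)).ennreal_toReal
      have h1 := weak_type_of_strong_type hr hδ0 hn μ hFtop (hkak δ hδ1 _ hFtop)
        (hmax δ hδ1 _ hmeas) (E := Ek k) (fun e he => hE he.1) (fun e he => he.2)
      have h2 := tsum_cellWeight_rpow_le hs ht.le htu.le hD0 (ediam_cellImage_le hn hhol) hQsum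
        (u := u) k
      have h3 : ENNReal.ofReal (b * δ * a k) * μ (Ek k) ^ r⁻¹ ≤
          ENNReal.ofReal (A * ω * β ^ (2 * k) * δ) := by
        rw [ENNReal.ofReal_mul (by positivity)]
        refine h1.trans ?_
        rw [← scale_bound_eq hn hs hθ.1 hβ hε hD hω k,
          ENNReal.ofReal_mul (p := C * δ ^ (-(((n : ℝ) - s) / s) - ε)) (by positivity), ← ENNReal.ofReal_rpow_of_nonneg (mul_nonneg (mul_nonneg (Real.rpow_nonneg (hD0 k) _)
            (by positivity)) (by positivity)) (by positivity),
          ENNReal.ofReal_mul (mul_nonneg (Real.rpow_nonneg (hD0 k) _) (by positivity))]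
        gcongr
      refine (measure_le_of_scale_bound (mul_pos (mul_pos hb hδ0) (ha0 k)) hr h3).trans
        (le_of_eq ?_)
      have h4 : A * ω * β ^ (2 * k) * δ / (b * δ * a k) = M * ω * β ^ k := by
        rw [hM, ha, pow_mul' β 2 k]
        field_simp
      rw [h4, ENNReal.ofReal_rpow_of_nonneg (by positivity) hr.le,
        Real.mul_rpow (by positivity) (by positivity), ← Real.rpow_natCast β k,
        ← Real.rpow_natCast (β ^ r) k, ← Real.rpow_mul hβ0.le, ← Real.rpow_mul hβ0.le, mul_comm r]
    calc μ E ≤ ∑' k, μ (Ek k) := (measure_mono hsub).trans (measure_iUnion_le _)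
      _ ≤ ∑' k, ENNReal.ofReal ((M * ω) ^ r * (β ^ r) ^ k) := ENNReal.tsum_le_tsum hEkle
      _ = _ := by
        have h5 := (hasSum_geometric_of_lt_one hβr0.le hβr).mul_left ((M * ω) ^ r)
        rw [← ENNReal.ofReal_tsum_of_nonneg (fun k => by positivity) h5.summable, h5.tsum_eq]
  have hlim : Filter.Tendsto (fun ω : ℝ => ENNReal.ofReal ((M * ω) ^ r * (1 - β ^ r)⁻¹))
      (nhdsWithin 0 (Set.Ioi 0)) (nhds 0) := by
    have hcont : Continuous fun ω : ℝ => ENNReal.ofReal ((M * ω) ^ r * (1 - β ^ r)⁻¹) :=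
      ENNReal.continuous_ofReal.comp (((continuous_const.mul continuous_id).rpow_const
        fun _ => Or.inr hr.le).mul continuous_const)
    have := (hcont.tendsto 0).mono_left (nhdsWithin_le_nhds (s := Set.Ioi 0))
    simpa [Real.zero_rpow hr.ne'] using this
  exact le_antisymm (ge_of_tendsto hlim (eventually_mem_nhdsWithin.mono key)) zero_le

/-- Wolff's Kakeya maximal estimate (`s = (n+2)/2`, `r = (n-1)(n+2)/n`) implies that a
quasisymmetry of a Kakeya set onto an at most `n`-dimensional metric space maps almost every
unit segment of the Kakeya set onto a set of dimension at most `2n/(n+2)`. -/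
theorem stmt16 {n : ℕ} (hn : 2 ≤ n)
    (hyp : ∀ ε > (0:ℝ), ∃ C > (0:ℝ), ∀ δ ∈ Set.Ioo (0:ℝ) 1,
      ∀ f : EuclideanSpace ℝ (Fin n) → ℝ, Measurable f →
        (∫⁻ e in Metric.sphere (0 : EuclideanSpace ℝ (Fin n)) 1,
            (kakeyaMax δ f e) ^ (((n : ℝ) - 1) * ((n : ℝ) + 2) / (n : ℝ))
              ∂(μH[((n : ℝ) - 1)])) ^ ((n : ℝ) / (((n : ℝ) - 1) * ((n : ℝ) + 2))) ≤
          ENNReal.ofReal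
              (C * δ ^ (-(((n : ℝ) - ((n : ℝ) + 2) / 2) / (((n : ℝ) + 2) / 2)) - ε)) *
            (∫⁻ y, ENNReal.ofReal |f y| ^ (((n : ℝ) + 2) / 2)) ^ (2 / ((n : ℝ) + 2)))
    {X : Type*} [MetricSpace X] [MeasurableSpace X] [BorelSpace X]
    (K S : Set (EuclideanSpace ℝ (Fin n)))
    (hS : S ⊆ Metric.sphere (0 : EuclideanSpace ℝ (Fin n)) 1)
    (hSpos : 0 < μH[((n : ℝ) - 1)] S)
    (hKak : ∀ e ∈ S, ∃ x, seg e x ⊆ K)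
    (g : EuclideanSpace ℝ (Fin n) → X) (η : ℝ → ℝ)
    (hη : IsQSGauge η) (hqs : IsQSOn η g K) (hinj : Set.InjOn g K)
    (hdim : dimH (Set.univ : Set X) ≤ (n : ℝ≥0∞)) :
    μH[((n : ℝ) - 1)]
      {e ∈ Metric.sphere (0 : EuclideanSpace ℝ (Fin n)) 1 |
        ∃ x, seg e x ⊆ K ∧
          ¬ dimH (g '' seg e x) ≤ ENNReal.ofReal (2 * (n : ℝ) / ((n : ℝ) + 2))} = 0 := by
  have hn0 : (0:ℝ) < n := by exact_mod_cast (by omega : 0 < n)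
  have hn1 : (0:ℝ) < (n:ℝ) - 1 := by
    have : (2:ℝ) ≤ n := by exact_mod_cast hn
    linarith
  set bad : ℚ × ℕ × ℕ → Set (EuclideanSpace ℝ (Fin n)) := fun p =>
    {e ∈ Metric.sphere (0 : EuclideanSpace ℝ (Fin n)) 1 | 2 * (n : ℝ) / ((n : ℝ) + 2) < p.1 ∧
      ∃ x, seg e x ⊆ K ∩ Metric.closedBall 0 ((p.2.2 : ℝ) + 1) ∧
        ∀ T : ℕ × (Fin n → ℤ) → Set X, g '' seg e x ⊆ ⋃ i, T i →
          ENNReal.ofReal (1 / ((p.2.1 : ℝ) + 1)) ≤ ∑' i, Metric.ediam (T i) ^ (p.1 : ℝ)} with hbad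
  refine measure_mono_null (t := ⋃ p, bad p) ?_ (measure_iUnion_null fun p => ?_)
  · rintro e ⟨he, x, hx, hlt⟩
    obtain ⟨q, hq0, hq1, hq2⟩ := ENNReal.lt_iff_exists_rat_btwn.1 (not_le.1 hlt)
    have hqlt : 2 * (n : ℝ) / ((n : ℝ) + 2) < q :=
      (Real.toNNReal_lt_toNNReal_iff_of_nonneg (by positivity)).1 (ENNReal.coe_lt_coe.1 hq1)
    have hqcoe : ((Real.toNNReal (q : ℝ) : NNReal) : ℝ) = q :=
      Real.coe_toNNReal _ (by exact_mod_cast hq0)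
    have hH := hausdorffMeasure_of_lt_dimH hq2
    rw [hqcoe] at hH
    obtain ⟨N, hN⟩ := exists_pos_le_tsum_ediam_of_hausdorffMeasure_ne_zero
      (ι := ℕ × (Fin n → ℤ)) (u := (q : ℝ)) (lt_trans (by positivity) hqlt)
      (by rw [hH]; exact ENNReal.top_ne_zero)
    refine Set.mem_iUnion.2 ⟨(q, N, ⌈‖x‖⌉₊), he, hqlt, x, Set.subset_inter hx ?_, hN⟩
    rintro _ ⟨t, ⟨ht0, ht1⟩, rfl⟩
    rw [mem_closedBall_zero_iff]
    refine (norm_add_le _ _).trans (add_le_add (Nat.le_ceil _) ?_)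
    rw [norm_smul, mem_sphere_zero_iff_norm.1 he, mul_one, Real.norm_of_nonneg ht0]
    exact ht1
  · obtain ⟨q, N, R⟩ := p
    by_cases hq : 2 * (n : ℝ) / ((n : ℝ) + 2) < q
    swap
    · convert measure_empty (μ := μH[((n : ℝ) - 1)])
      exact Set.eq_empty_of_forall_notMem fun e he => hq he.2.1
    have hq0 : (0:ℝ) < q := lt_trans (by positivity) hq
    have hqs' : (n : ℝ) < q * (((n : ℝ) + 2) / 2) := by
      rw [div_lt_iff₀ (by positivity)] at hq; linarith
    obtain ⟨t, hnt, htq⟩ := exists_between hqs'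
    have ht0 : 0 < t := hn0.trans hnt
    have hHt : μH[t] (Set.univ : Set X) = 0 := by
      have := hausdorffMeasure_of_dimH_lt (s := (Set.univ : Set X)) (d := t.toNNReal)
        (hdim.trans_lt (by
          rw [← ENNReal.coe_natCast, ENNReal.coe_lt_coe, Real.lt_toNNReal_iff_coe_lt]
          exact_mod_cast hnt))
      rwa [Real.coe_toNNReal _ ht0.le] at this
    set K' : Set (EuclideanSpace ℝ (Fin n)) := {y | ∃ e x, ‖e‖ = 1 ∧ y ∈ seg e x ∧
      seg e x ⊆ K ∩ Metric.closedBall 0 ((R : ℝ) + 1)} with hK'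
    have hK'sub : K' ⊆ K ∩ Metric.closedBall 0 ((R : ℝ) + 1) := by
      rintro y ⟨e, x, -, hy, hsub⟩
      exact hsub hy
    have hseg : ∀ e x, ‖e‖ = 1 → seg e x ⊆ K ∩ Metric.closedBall 0 ((R : ℝ) + 1) →
        seg e x ⊆ K' := fun e x he hsub y hy => ⟨e, x, he, hy, hsub⟩
    refine measure_directions_eq_zero (by omega) (r := ((n : ℝ) - 1) * ((n : ℝ) + 2) / n)
      (s := ((n : ℝ) + 2) / 2) (by positivity) (by positivity) _ ?_ hη (K := K')
      (fun x hx y hy z hz => hqs x (hK'sub hx).1 y (hK'sub hy).1 z (hK'sub hz).1)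
      (fun x hx => ?_) (by positivity : (0:ℝ) < (R : ℝ) + 1)
      (hK'sub.trans Set.inter_subset_right) ht0 hq0 htq hHt
      (by positivity : (0:ℝ) < 1 / ((N : ℝ) + 1)) (fun e he => he.1) fun e he => ?_
    · simpa only [inv_div] using hyp
    · obtain ⟨e, x₀, he, hxs, hsub⟩ := hx
      exact ⟨e, x₀, he, hxs, hseg e x₀ he hsub⟩
    · obtain ⟨he1, -, x, hsub, hT⟩ := he
      exact ⟨x, hseg e x (mem_sphere_zero_iff_norm.1 he1) hsub, hT⟩
end
end
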